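/- arXiv:2507.02701 — 3 statements merged into one kernel-verified Lean document; each statement's English description precedes it below -/
import Mathlib

section
/- Consider fragments F[l_F..r_F) and G[l_G..r_G) of forests F, G ∈ F_Σ, a normalized weight function w : (Σ∪{ε})² → ℝ≥0, and a threshold k ∈ ℤ+ such that |r_F − r_G| ≤ 2k. If there is a free pair F[p_F..q_F) = G[p_G..q_G) = R^e (with period R and exponent e) such that F[p_F..q_F) is a suffix of F[l_F..r_F), then: bted_k^w(F[l_F..r_F), G[l_G..r_G)) ≥ min over p'_G ∈ [p_G−|R|..p_G+|R|] of (bted_k^w(F[l_F..p_F), G[l_G..p'_G)) + M_R^e[p'_G−p_G, r_G−q_G]) ≥ min over p'_G ∈ [p_G−|R|..p_G+|R|] of (ted^w(F[l_F..p_F), G[l_G..p'_G)) + M_R^e[p'_G−p_G, r_G−q_G]) ≥ ted^w(F[l_F..r_F), G[l_G..r_G)). -/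
open scoped NNReal ENNReal

attribute [local instance] Classical.propDecidable

/-- A labeled parenthesis over the alphabet `α`: `(true, a)` is the opening
parenthesis with label `a`, and `(false, a)` is the closing parenthesis. -/
abbrev Paren (α : Type*) := Bool × α

/-- Balanced strings of labeled parentheses (forests), following Definition 2.1:
the smallest set containing the empty string, closed under concatenation, and
containing `(_a · F · )_a` for every forest `F` and label `a`. -/
inductive IsForest {α : Type*} : List (Paren α) → Prop
  | nil : IsForest []
  | append {F G : List (Paren α)} : IsForest F → IsForest G → IsForest (F ++ G)
  | wrap {F : List (Paren α)} (a : α) : IsForest F → IsForest ((true, a) :: F ++ [(false, a)])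

/-- The fragment `l[i..j)` of a list. -/
def frag {β : Type*} (l : List β) (i j : ℕ) : List β := (l.take j).drop i

/-- `IsNode F i j` means that `[i..j]` is a node of the forest `F`: `F[i]` is an
opening parenthesis, `F[j]` is a closing parenthesis with the same label,
and `F(i..j)` is balanced. -/
def IsNode {α : Type*} (F : List (Paren α)) (i j : ℕ) : Prop :=
  i < j ∧ j < F.length ∧ (∃ a : α, F[i]? = some (true, a) ∧ F[j]? = some (false, a)) ∧
    IsForest (frag F (i + 1) j)

/-- `MateRel F i j` holds when positions `i` and `j` are the paired parentheses
of a node of `F` (in either order); `j` is the mate of `i`. -/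
def MateRel {α : Type*} (F : List (Paren α)) (i j : ℕ) : Prop :=
  IsNode F i j ∨ IsNode F j i

/-- A single edge of the alignment graph: horizontal, vertical, or diagonal. -/
def AlignStep (p q : ℕ × ℕ) : Prop :=
  q = (p.1 + 1, p.2) ∨ q = (p.1, p.2 + 1) ∨ q = (p.1 + 1, p.2 + 1)

/-- An alignment of `X[x..x')` onto `Y[y..y')` is a path in the alignment graph
from `(x, y)` to `(x', y')`, interpreted as its sequence of vertices. -/
def IsAlignment (x x' y y' : ℕ) (path : List (ℕ × ℕ)) : Prop :=
  path.head? = some (x, y) ∧ path.getLast? = some (x', y') ∧ path.Chain' AlignStep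

/-- The alignment (path) aligns character `f` of `X` to character `g` of `Y`
(a diagonal edge `(f, g) → (f + 1, g + 1)`). -/
def AlignsAt (path : List (ℕ × ℕ)) (f g : ℕ) : Prop :=
  ∃ t, path[t]? = some (f, g) ∧ path[t + 1]? = some (f + 1, g + 1)

/-- The alignment deletes character `f` of `X` (a horizontal edge). -/
def DeletesAt (path : List (ℕ × ℕ)) (f : ℕ) : Prop :=
  ∃ t g, path[t]? = some (f, g) ∧ path[t + 1]? = some (f + 1, g)

/-- The alignment inserts character `g` of `Y` (a vertical edge). -/
def InsertsAt (path : List (ℕ × ℕ)) (g : ℕ) : Prop :=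
  ∃ t f, path[t]? = some (f, g) ∧ path[t + 1]? = some (f, g + 1)

/-- Consistency condition of forest alignments (Definition 2.6): whenever the
alignment aligns `F[f]` to `G[g]`, it also aligns the mate of `F[f]` to the mate
of `G[g]`.  An alignment satisfying this condition is a forest alignment. -/
def Consistent {α : Type*} (F G : List (Paren α)) (path : List (ℕ × ℕ)) : Prop :=
  ∀ f g f' g', AlignsAt path f g → MateRel F f f' → MateRel G g g' → AlignsAt path f' g'

/-- The width of the alignment is at most `m`: every vertex `(x, y)` on the path
satisfies `|x - y| ≤ m`. -/
def WidthLE (m : ℕ) (path : List (ℕ × ℕ)) : Prop :=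
  ∀ p ∈ path, p.1 ≤ p.2 + m ∧ p.2 ≤ p.1 + m

/-- The label of the `i`-th character of `X` (as an element of `Σ ∪ {ε}`,
encoded by `Option α`; out-of-range positions give `ε`). -/
def lbl {α : Type*} (X : List (Paren α)) (i : ℕ) : Option α := (X[i]?).map Prod.snd

/-- Cost of an alignment path with respect to the weight function `w̃(p, q) = ½·w(λ(p), λ(q))`:
horizontal edges cost `½·w(λ(X[x]), ε)`, vertical edges `½·w(ε, λ(Y[y]))`, and
diagonal edges `½·w(λ(X[x]), λ(Y[y]))`. -/
noncomputable def pathCost {α : Type*} (w : Option α → Option α → ℝ≥0)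
    (X Y : List (Paren α)) : List (ℕ × ℕ) → ℝ≥0
  | [] => 0
  | [_] => 0
  | p :: q :: rest =>
      (if q.1 = p.1 + 1 ∧ q.2 = p.2 then (1 / 2 : ℝ≥0) * w (lbl X p.1) none
       else if q.1 = p.1 ∧ q.2 = p.2 + 1 then (1 / 2 : ℝ≥0) * w none (lbl Y p.2)
       else (1 / 2 : ℝ≥0) * w (lbl X p.1) (lbl Y p.2)) + pathCost w X Y (q :: rest)

/-- A weight function `w : (Σ ∪ {ε})² → ℝ≥0` is normalized if `w(a, a) = 0` and
`w(a, b) ≥ 1` for distinct `a, b`. -/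
def Normalized {α : Type*} (w : Option α → Option α → ℝ≥0) : Prop :=
  (∀ a, w a a = 0) ∧ ∀ a b, a ≠ b → 1 ≤ w a b

/-- A weight function satisfies the triangle inequality (is a quasimetric). -/
def Quasimetric {α : Type*} (w : Option α → Option α → ℝ≥0) : Prop :=
  ∀ a b c, w a c ≤ w a b + w b c

/-- The weighted tree edit distance `ted^w(F[f..f'), G[g..g'))`: the minimum cost
of a forest alignment of the fragment `F[f..f')` onto the fragment `G[g..g')`
(`∞` if no forest alignment exists). -/
noncomputable def tedFrag {α : Type*} (w : Option α → Option α → ℝ≥0)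
    (F G : List (Paren α)) (f f' g g' : ℕ) : ℝ≥0∞ :=
  ⨅ p : { p : List (ℕ × ℕ) // IsAlignment f f' g g' p ∧ Consistent F G p },
    (pathCost w F G p.1 : ℝ≥0∞)

/-- The bounded tree edit distance `bted_k^w(F[f..f'), G[g..g'))`: the minimum
cost of a forest alignment of width at most `2k` (`∞` if none exists). -/
noncomputable def btedFrag {α : Type*} (k : ℕ) (w : Option α → Option α → ℝ≥0)
    (F G : List (Paren α)) (f f' g g' : ℕ) : ℝ≥0∞ :=
  ⨅ p : { p : List (ℕ × ℕ) //
      IsAlignment f f' g g' p ∧ Consistent F G p ∧ WidthLE (2 * k) p },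
    (pathCost w F G p.1 : ℝ≥0∞)

/-- The `e`-fold concatenation `R^e` of a string. -/
def listPow {β : Type*} (R : List β) : ℕ → List β
  | 0 => []
  | e + 1 => R ++ listPow R e

/-- The matrix `M_R` (Definition 4.3), with indices `i, j ∈ [−|R|..|R|]`:
`M_R[i, j] = ted^w(R, R³[|R| + i..2|R| + j))` when `|R| + i ≤ 2|R| + j`, and `∞`
otherwise. -/
noncomputable def MR {α : Type*} (w : Option α → Option α → ℝ≥0) (R : List (Paren α))
    (i j : ℤ) : ℝ≥0∞ :=
  if (R.length : ℤ) + i ≤ 2 * (R.length : ℤ) + j then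
    tedFrag w R (listPow R 3) 0 R.length ((R.length : ℤ) + i).toNat
      (2 * (R.length : ℤ) + j).toNat
  else ⊤

/-- Min-plus product of matrices with indices in `[−n..n]`. -/
noncomputable def minplus (n : ℕ) (A B : ℤ → ℤ → ℝ≥0∞) : ℤ → ℤ → ℝ≥0∞ :=
  fun i l => (Finset.Icc (-(n : ℤ)) (n : ℤ)).inf fun j => A i j + B j l

/-- The `e`-th min-plus power of a matrix with indices in `[−n..n]`. -/
noncomputable def mpPow (n : ℕ) (A : ℤ → ℤ → ℝ≥0∞) : ℕ → ℤ → ℤ → ℝ≥0∞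
  | 0 => fun i j => if i = j then 0 else ⊤
  | e + 1 => minplus n (mpPow n A e) A

namespace TedAux

variable {α : Type*}

/-- Height of a string of parentheses. -/
def ht (l : List (Paren α)) : ℤ := (l.map fun p => if p.1 then (1 : ℤ) else -1).sum

theorem ht_append (l m : List (Paren α)) : ht (l ++ m) = ht l + ht m := by
  simp [ht]

theorem ht_forest {F : List (Paren α)} (h : IsForest F) : ht F = 0 := by
  induction h with
  | nil => simp [ht]
  | append _ _ ih1 ih2 => rw [ht_append, ih1, ih2]; rfl
  | wrap a _ ih =>
    rw [ht_append, ← List.singleton_append, ht_append, ih]; simp [ht]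

theorem ht_prefix {F : List (Paren α)} (h : IsForest F) :
    ∀ A B, F = A ++ B → 0 ≤ ht A := by
  induction h with
  | nil =>
    intro A B hAB
    have : A = [] := by simp_all
    subst this; simp [ht]
  | @append F G h1 h2 ih1 ih2 =>
    intro A B hAB
    rcases List.append_eq_append_iff.mp hAB with ⟨C, hA, hB⟩ | ⟨C, hA, hB⟩
    · subst hA
      rw [ht_append, ht_forest h1, zero_add]
      exact ih2 _ _ hB
    · exact ih1 _ _ hA
  | @wrap F a h1 ih =>
    intro A B hAB
    rcases A with _ | ⟨p, A⟩
    · simp [ht]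
    · simp only [List.cons_append, List.cons.injEq] at hAB
      obtain ⟨hp, hAB⟩ := hAB
      subst hp
      have key : ht ((true, a) :: A) = 1 + ht A := by simp [ht]
      rw [key]
      rcases List.append_eq_append_iff.mp hAB with ⟨C, hA, hB⟩ | ⟨C, hA, hB⟩
      · subst hA
        rw [ht_append, ht_forest h1]
        rcases C with _ | ⟨c, C⟩
        · simp [ht]
        · simp only [List.cons_append, List.cons.injEq] at hB
          obtain ⟨hc, hB⟩ := hB
          have : C = [] := (List.append_eq_nil_iff.mp hB.symm).1
          subst this; subst hc; simp [ht]
      · have := ih _ _ hA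
        linarith

theorem frag_split {β : Type*} (l : List β) {i j m : ℕ} (h1 : i ≤ j) (h2 : j ≤ m) :
    frag l i m = frag l i j ++ frag l j m := by
  unfold frag
  apply List.ext_getElem?
  intro t
  simp only [List.getElem?_append, List.getElem?_drop, List.getElem?_take, List.length_drop,
    List.length_take]
  grind

theorem frag_cons {β : Type*} (l : List β) {i m : ℕ} (h : i < m) {a : β}
    (ha : l[i]? = some a) : frag l i m = a :: frag l (i + 1) m := by
  unfold frag
  apply List.ext_getElem?
  intro t
  cases t <;> simp only [List.getElem?_cons_zero, List.getElem?_cons_succ, List.getElem?_drop,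
    List.getElem?_take] <;> grind

theorem node_unique_right {F : List (Paren α)} {i j j' : ℕ} (h : IsNode F i j)
    (h' : IsNode F i j') : ¬ j < j' := by
  intro hlt
  obtain ⟨h1, h2, ⟨a, h3, h4⟩, h5⟩ := h
  obtain ⟨h1', h2', -, h5'⟩ := h'
  have e1 : frag F (i + 1) j' = (frag F (i + 1) j ++ [(false, a)]) ++ frag F (j + 1) j' := by
    rw [frag_split F (i := i + 1) (j := j) (m := j') (by omega) (by omega), frag_cons F hlt h4]
    simp
  have := ht_prefix h5' _ _ e1
  rw [ht_append, ht_forest h5] at this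
  simp [ht] at this

theorem node_unique_left {F : List (Paren α)} {i i' j : ℕ} (h : IsNode F i j)
    (h' : IsNode F i' j) : ¬ i < i' := by
  intro hlt
  obtain ⟨h1, h2, -, h5⟩ := h
  obtain ⟨h1', h2', ⟨a, h3, h4⟩, h5'⟩ := h'
  have e1 : frag F (i + 1) j = frag F (i + 1) i' ++ ([(true, a)] ++ frag F (i' + 1) j) := by
    rw [frag_split F (i := i + 1) (j := i') (m := j) (by omega) (by omega), frag_cons F h1' h3]
    simp
  have h6 := ht_prefix h5 _ _ e1
  have h7 := ht_forest h5
  rw [e1, ht_append, ht_append, ht_forest h5'] at h7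
  simp [ht] at h7 h6
  omega

theorem mate_unique {F : List (Paren α)} {i j j' : ℕ} (h : MateRel F i j)
    (h' : MateRel F i j') : j = j' := by
  rcases h with h | h <;> rcases h' with h' | h'
  · have := node_unique_right h h'
    have := node_unique_right h' h
    omega
  · obtain ⟨a, h3, h4⟩ := h.2.2.1
    obtain ⟨a', h3', h4'⟩ := h'.2.2.1
    simp_all
  · obtain ⟨a, h3, h4⟩ := h.2.2.1
    obtain ⟨a', h3', h4'⟩ := h'.2.2.1
    simp_all
  · have := node_unique_left h h'
    have := node_unique_left h' h
    omega

theorem mate_symm {F : List (Paren α)} {i j : ℕ} (h : MateRel F i j) : MateRel F j i :=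
  Or.symm h

theorem mate_lt {F : List (Paren α)} {i j : ℕ} (h : MateRel F i j) :
    i < F.length ∧ j < F.length := by
  rcases h with h | h
  · exact ⟨h.1.trans h.2.1, h.2.1⟩
  · exact ⟨h.2.1, h.1.trans h.2.1⟩

theorem getElem?_embed {β : Type*} (A X B : List β) {i : ℕ} (h : i < X.length) :
    (A ++ X ++ B)[A.length + i]? = X[i]? := by
  rw [List.append_assoc, List.getElem?_append_right (by omega), List.getElem?_append_left (by omega)]
  congr 1
  omega

theorem node_embed (A B : List (Paren α)) {X : List (Paren α)} {i j : ℕ} (h : IsNode X i j) :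
    IsNode (A ++ X ++ B) (A.length + i) (A.length + j) := by
  obtain ⟨h1, h2, ⟨a, h3, h4⟩, h5⟩ := h
  refine ⟨by omega, by simp; omega, ⟨a, ?_, ?_⟩, ?_⟩
  · rw [getElem?_embed _ _ _ (by omega), h3]
  · rw [getElem?_embed _ _ _ (by omega), h4]
  · convert h5 using 1
    unfold frag
    apply List.ext_getElem?
    intro t
    simp only [List.getElem?_drop, List.getElem?_take]
    by_cases ht : i + 1 + t < j
    · rw [if_pos (by omega), if_pos ht, ← getElem?_embed A X B (by omega)]
      congr 1
      omega
    · rw [if_neg (by omega), if_neg ht]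

theorem mate_embed (A B : List (Paren α)) {X : List (Paren α)} {i j : ℕ} (h : MateRel X i j) :
    MateRel (A ++ X ++ B) (A.length + i) (A.length + j) :=
  h.imp (node_embed A B) (node_embed A B)

theorem mate_exists {F : List (Paren α)} (h : IsForest F) :
    ∀ i < F.length, ∃ j, MateRel F i j := by
  induction h with
  | nil => intro i hi; simp at hi
  | @append F G h1 h2 ih1 ih2 =>
    intro i hi
    by_cases hl : i < F.length
    · obtain ⟨j, hj⟩ := ih1 i hl
      exact ⟨j, by simpa using mate_embed [] G hj⟩
    · simp only [List.length_append] at hi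
      obtain ⟨j, hj⟩ := ih2 (i - F.length) (by omega)
      refine ⟨F.length + j, ?_⟩
      have := mate_embed F [] hj
      rw [List.append_nil] at this
      convert this using 1
      omega
  | @wrap F a h1 ih =>
    intro i hi
    have hnode : IsNode ((true, a) :: F ++ [(false, a)]) 0 (F.length + 1) := by
      refine ⟨by omega, by simp, ⟨a, by simp, by simp⟩, ?_⟩
      simpa [frag] using h1
    simp only [List.length_append, List.length_cons, List.length_nil] at hi
    by_cases h0 : i = 0
    · subst h0; exact ⟨_, Or.inl hnode⟩
    by_cases h2 : i = F.length + 1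
    · subst h2; exact ⟨_, Or.inr hnode⟩
    obtain ⟨j, hj⟩ := ih (i - 1) (by omega)
    refine ⟨1 + j, ?_⟩
    have := mate_embed [(true, a)] [(false, a)] hj
    rwa [List.length_singleton, show 1 + (i - 1) = i by omega] at this

theorem mate_inside (A B : List (Paren α)) {X : List (Paren α)} (hX : IsForest X) {i j' : ℕ}
    (hi : i < X.length) (h : MateRel (A ++ X ++ B) (A.length + i) j') :
    ∃ j, j' = A.length + j ∧ MateRel X i j := by
  obtain ⟨j, hj⟩ := mate_exists hX i hi
  exact ⟨j, mate_unique h (mate_embed A B hj), hj⟩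

/-! ### Paths -/

theorem alignsAt_cons (v u : ℕ × ℕ) (l : List (ℕ × ℕ)) (f g : ℕ) :
    AlignsAt (v :: u :: l) f g ↔
      (v = (f, g) ∧ u = (f + 1, g + 1)) ∨ AlignsAt (u :: l) f g := by
  constructor
  · rintro ⟨t, h1, h2⟩
    cases t with
    | zero => left; simpa using And.intro h1 h2
    | succ t => right; exact ⟨t, by simpa using h1, by simpa using h2⟩
  · rintro (⟨rfl, rfl⟩ | ⟨t, h1, h2⟩)
    · exact ⟨0, by simp, by simp⟩
    · exact ⟨t + 1, by simpa using h1, by simpa using h2⟩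

theorem not_alignsAt_single (v : ℕ × ℕ) (f g : ℕ) : ¬ AlignsAt [v] f g := by
  rintro ⟨t, h1, h2⟩
  simp at h2

theorem alignsAt_join (A B : List (ℕ × ℕ)) (v : ℕ × ℕ) (f g : ℕ) :
    AlignsAt (A ++ v :: B) f g ↔ AlignsAt (A ++ [v]) f g ∨ AlignsAt (v :: B) f g := by
  induction A with
  | nil => simp [not_alignsAt_single]
  | cons a A ih =>
    cases A with
    | nil => simp [alignsAt_cons, not_alignsAt_single]
    | cons b A =>
      simp only [List.cons_append, alignsAt_cons] at ih ⊢
      rw [ih, or_assoc]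

theorem pathCost_join (w : Option α → Option α → ℝ≥0) (X Y : List (Paren α))
    (A B : List (ℕ × ℕ)) (v : ℕ × ℕ) :
    pathCost w X Y (A ++ v :: B) = pathCost w X Y (A ++ [v]) + pathCost w X Y (v :: B) := by
  induction A with
  | nil => simp [pathCost]
  | cons a A ih =>
    cases A with
    | nil => simp [pathCost]
    | cons b A =>
      simp only [List.cons_append, pathCost] at ih ⊢
      rw [ih, add_assoc]

theorem isAlignment_single (x x' y y' : ℕ) (v : ℕ × ℕ) :
    IsAlignment x x' y y' [v] ↔ v = (x, y) ∧ v = (x', y') := by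
  simp [IsAlignment, List.Chain']

theorem isAlignment_cons (x x' y y' : ℕ) (v u : ℕ × ℕ) (l : List (ℕ × ℕ)) :
    IsAlignment x x' y y' (v :: u :: l) ↔
      v = (x, y) ∧ AlignStep v u ∧ IsAlignment u.1 x' u.2 y' (u :: l) := by
  simp [IsAlignment, List.Chain']
  tauto

theorem isAlignment_join (x x' y y' : ℕ) (A B : List (ℕ × ℕ)) (v : ℕ × ℕ) :
    IsAlignment x x' y y' (A ++ v :: B) ↔
      IsAlignment x v.1 y v.2 (A ++ [v]) ∧ IsAlignment v.1 x' v.2 y' (v :: B) := by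
  induction A generalizing x y with
  | nil =>
    cases B with
    | nil =>
      simp only [List.nil_append, isAlignment_single]
      grind
    | cons b B =>
      simp only [List.nil_append, isAlignment_single, isAlignment_cons]
      grind
  | cons a A ih =>
    cases A with
    | nil => simp only [List.cons_append, List.nil_append, isAlignment_single, isAlignment_cons]; grind
    | cons b A =>
      have := ih b.1 b.2
      simp only [List.cons_append, isAlignment_cons] at this ⊢
      rw [this]
      tauto

theorem isAlignment_le {x x' y y' : ℕ} {P : List (ℕ × ℕ)} (h : IsAlignment x x' y y' P) :
    x ≤ x' ∧ y ≤ y' ∧ ∀ v ∈ P, x ≤ v.1 ∧ v.1 ≤ x' ∧ y ≤ v.2 ∧ v.2 ≤ y' := by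
  induction P generalizing x y with
  | nil => simp [IsAlignment] at h
  | cons v P ih =>
    cases P with
    | nil =>
      rw [isAlignment_single] at h
      grind
    | cons u P =>
      rw [isAlignment_cons] at h
      obtain ⟨h1, h2, h3⟩ := h
      obtain ⟨h4, h5, h6⟩ := ih h3
      unfold AlignStep at h2
      subst h1
      have : x ≤ u.1 ∧ y ≤ u.2 := by
        rcases h2 with h2 | h2 | h2 <;> rw [h2] <;> simp
      refine ⟨by omega, by omega, ?_⟩
      intro p hp
      rw [List.mem_cons] at hp
      rcases hp with rfl | hp
      · simp; omega
      · have := h6 p hp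
        omega

theorem alignsAt_bounds {x x' y y' : ℕ} {P : List (ℕ × ℕ)} (h : IsAlignment x x' y y' P)
    {f g : ℕ} (hf : AlignsAt P f g) : x ≤ f ∧ f < x' ∧ y ≤ g ∧ g < y' := by
  obtain ⟨t, h1, h2⟩ := hf
  have h3 := (isAlignment_le h).2.2 _ (List.mem_of_getElem? h1)
  have h4 := (isAlignment_le h).2.2 _ (List.mem_of_getElem? h2)
  simp at h3 h4
  omega

theorem exists_vertex {x x' y y' : ℕ} {P : List (ℕ × ℕ)} (h : IsAlignment x x' y y' P)
    {c : ℕ} (h1 : x ≤ c) (h2 : c ≤ x') : ∃ v ∈ P, v.1 = c := by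
  induction P generalizing x y with
  | nil => simp [IsAlignment] at h
  | cons v P ih =>
    cases P with
    | nil =>
      rw [isAlignment_single] at h
      refine ⟨v, by simp, ?_⟩
      obtain ⟨h3, h4⟩ := h
      rw [h3] at h4
      simp at h4
      rw [h3]
      simp; omega
    | cons u P =>
      rw [isAlignment_cons] at h
      obtain ⟨h3, h4, h5⟩ := h
      by_cases hc : x = c
      · exact ⟨v, by simp, by rw [h3]; exact hc⟩
      · have : u.1 ≤ c := by
          subst h3
          rcases h4 with h4 | h4 | h4 <;> rw [h4] <;> simp <;> omega
        obtain ⟨q, hq, hq'⟩ := ih h5 this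
        exact ⟨q, List.mem_cons_of_mem _ hq, hq'⟩

/-- Shift of a vertex. -/
def sh (a b : ℕ) (v : ℕ × ℕ) : ℕ × ℕ := (a + v.1, b + v.2)

theorem isAlignment_shift (a b x x' y y' : ℕ) (P : List (ℕ × ℕ)) :
    IsAlignment (a + x) (a + x') (b + y) (b + y') (P.map (sh a b)) ↔
      IsAlignment x x' y y' P := by
  induction P generalizing x y with
  | nil => simp [IsAlignment]
  | cons v P ih =>
    cases P with
    | nil => simp [isAlignment_single, sh, Prod.ext_iff]
    | cons u P =>
      have := ih u.1 u.2
      simp only [List.map_cons, isAlignment_cons] at this ⊢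
      rw [show (sh a b u).1 = a + u.1 from rfl, show (sh a b u).2 = b + u.2 from rfl, this]
      simp only [sh, AlignStep, Prod.ext_iff]
      grind

theorem alignsAt_shift (a b f g : ℕ) (P : List (ℕ × ℕ)) :
    AlignsAt (P.map (sh a b)) (a + f) (b + g) ↔ AlignsAt P f g := by
  unfold AlignsAt
  simp only [List.getElem?_map, Option.map_eq_some_iff, sh, Prod.ext_iff]
  constructor
  · rintro ⟨t, ⟨p, h1, h2⟩, ⟨q, h3, h4⟩⟩
    refine ⟨t, ?_, ?_⟩
    · rw [h1]; simp [Prod.ext_iff] at *; omega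
    · rw [h3]; simp [Prod.ext_iff] at *; omega
  · rintro ⟨t, h1, h2⟩
    exact ⟨t, ⟨_, h1, by simp⟩, ⟨_, h2, by simp; omega⟩⟩

theorem pathCost_shift (w : Option α → Option α → ℝ≥0) (X Y X' Y' : List (Paren α)) (a b : ℕ)
    {x x' y y' : ℕ} (P : List (ℕ × ℕ)) (h : IsAlignment x x' y y' P)
    (hX : ∀ i < x', lbl X' (a + i) = lbl X i) (hY : ∀ i < y', lbl Y' (b + i) = lbl Y i) :
    pathCost w X' Y' (P.map (sh a b)) = pathCost w X Y P := by
  induction P generalizing x y with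
  | nil => simp [pathCost]
  | cons v P ih =>
    cases P with
    | nil => simp [pathCost]
    | cons u P =>
      have hle := (isAlignment_le h).2.2 u (by simp)
      rw [isAlignment_cons] at h
      have := ih h.2.2
      simp only [List.map_cons, pathCost] at this ⊢
      rw [this]
      congr 1
      obtain ⟨-, h2, -⟩ := h
      simp only [sh]
      rcases h2 with h2 | h2 | h2
      · subst h2
        have e1 := hX v.1 (by simp at hle; omega)
        simp [e1, add_assoc]
      · subst h2
        have e1 := hY v.2 (by simp at hle; omega)
        simp [e1, add_assoc]
      · subst h2
        have e1 := hX v.1 (by simp at hle; omega)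
        have e2 := hY v.2 (by simp at hle; omega)
        simp [e1, e2]

theorem exists_unshift {a b x x' y y' : ℕ} {P : List (ℕ × ℕ)}
    (h : IsAlignment (a + x) x' (b + y) y' P) : ∃ Q : List (ℕ × ℕ), P = Q.map (sh a b) := by
  refine ⟨P.map fun v => (v.1 - a, v.2 - b), ?_⟩
  rw [List.map_map]
  symm
  refine Eq.trans (List.map_congr_left (g := id) ?_) (List.map_id P)
  intro v hv
  have := (isAlignment_le h).2.2 v hv
  simp only [sh, Function.comp, id, Prod.ext_iff]
  omega

theorem lbl_embed (A X B : List (Paren α)) {i : ℕ} (h : i < X.length) :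
    lbl (A ++ X ++ B) (A.length + i) = lbl X i := by
  unfold lbl
  rw [getElem?_embed A X B h]

theorem consistent_shift (A B C D : List (Paren α)) {X Y : List (Paren α)}
    (hX : IsForest X) (hY : IsForest Y) {x x' y y' : ℕ} (hx' : x' ≤ X.length)
    (hy' : y' ≤ Y.length) {P : List (ℕ × ℕ)} (h : IsAlignment x x' y y' P) :
    Consistent (A ++ X ++ B) (C ++ Y ++ D) (P.map (sh A.length C.length)) ↔
      Consistent X Y P := by
  constructor
  · intro hc f g f' g' h1 h2 h3
    rw [← alignsAt_shift A.length C.length] at h1 ⊢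
    exact hc _ _ _ _ h1 (mate_embed _ _ h2) (mate_embed _ _ h3)
  · intro hc f g f' g' h1 h2 h3
    have hb := alignsAt_bounds ((isAlignment_shift A.length C.length x x' y y' P).2 h) h1
    obtain ⟨f, rfl⟩ := Nat.exists_eq_add_of_le (show A.length ≤ f by omega)
    obtain ⟨g, rfl⟩ := Nat.exists_eq_add_of_le (show C.length ≤ g by omega)
    obtain ⟨f', rfl, h4⟩ := mate_inside A B hX (by omega) h2
    obtain ⟨g', rfl, h5⟩ := mate_inside C D hY (by omega) h3
    rw [alignsAt_shift] at h1 ⊢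
    exact hc _ _ _ _ h1 h4 h5

theorem ted_embed (w : Option α → Option α → ℝ≥0) (A B C D : List (Paren α))
    {X Y : List (Paren α)} (hX : IsForest X) (hY : IsForest Y) {x x' y y' : ℕ}
    (hx' : x' ≤ X.length) (hy' : y' ≤ Y.length) :
    tedFrag w (A ++ X ++ B) (C ++ Y ++ D) (A.length + x) (A.length + x')
      (C.length + y) (C.length + y') = tedFrag w X Y x x' y y' := by
  have hlX : ∀ i < x', lbl (A ++ X ++ B) (A.length + i) = lbl X i :=
    fun i hi => lbl_embed A X B (by omega)
  have hlY : ∀ i < y', lbl (C ++ Y ++ D) (C.length + i) = lbl Y i :=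
    fun i hi => lbl_embed C Y D (by omega)
  apply le_antisymm
  · apply le_iInf
    rintro ⟨P, h1, h2⟩
    refine iInf_le_of_le ⟨P.map (sh A.length C.length), (isAlignment_shift _ _ _ _ _ _ _).2 h1,
      (consistent_shift A B C D hX hY hx' hy' h1).2 h2⟩ ?_
    rw [pathCost_shift w X Y _ _ _ _ P h1 hlX hlY]
  · apply le_iInf
    rintro ⟨P, h1, h2⟩
    obtain ⟨Q, rfl⟩ := exists_unshift h1
    rw [isAlignment_shift] at h1
    refine iInf_le_of_le ⟨Q, h1, (consistent_shift A B C D hX hY hx' hy' h1).1 h2⟩ ?_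
    rw [pathCost_shift w X Y _ _ _ _ Q h1 hlX hlY]

theorem ted_le_bted (k : ℕ) (w : Option α → Option α → ℝ≥0) (F G : List (Paren α))
    (f f' g g' : ℕ) : tedFrag w F G f f' g g' ≤ btedFrag k w F G f f' g g' := by
  apply le_iInf
  rintro ⟨P, h1, h2, -⟩
  exact iInf_le_of_le ⟨P, h1, h2⟩ le_rfl

theorem ted_concat (w : Option α → Option α → ℝ≥0) (F G : List (Paren α))
    (f m f' g m' g' : ℕ) :
    tedFrag w F G f f' g g' ≤ tedFrag w F G f m g m' + tedFrag w F G m f' m' g' := by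
  apply ENNReal.le_iInf_add_iInf
  rintro ⟨P, h1, h2⟩ ⟨Q, h3, h4⟩
  obtain ⟨A, rfl⟩ := List.getLast?_eq_some_iff.mp h1.2.1
  obtain ⟨B, rfl⟩ := List.head?_eq_some_iff.mp h3.1
  refine iInf_le_of_le ⟨A ++ (m, m') :: B, (isAlignment_join _ _ _ _ _ _ _).2 ⟨h1, h3⟩, ?_⟩ ?_
  · intro i j i' j' hij hi hj
    rw [alignsAt_join] at hij ⊢
    exact hij.imp (fun h => h2 _ _ _ _ h hi hj) (fun h => h4 _ _ _ _ h hi hj)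
  · simp only
    rw [pathCost_join, ENNReal.coe_add]

theorem bted_split (k : ℕ) (w : Option α → Option α → ℝ≥0) (A B : List (Paren α))
    {X : List (Paren α)} (hX : IsForest X) (G : List (Paren α)) {f g g' : ℕ}
    (hf : f ≤ A.length) (b : ℝ≥0∞)
    (hb : ∀ m', A.length ≤ m' + 2 * k → m' ≤ A.length + 2 * k → m' ≤ g' →
      b ≤ btedFrag k w (A ++ X ++ B) G f A.length g m' +
        btedFrag k w (A ++ X ++ B) G A.length (A.length + X.length) m' g') :
    b ≤ btedFrag k w (A ++ X ++ B) G f (A.length + X.length) g g' := by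
  apply le_iInf
  rintro ⟨P, h1, h2, h3⟩
  obtain ⟨v, hv, hvc⟩ := exists_vertex h1 hf (by omega)
  have hw := h3 v hv
  have hle := (isAlignment_le h1).2.2 v hv
  obtain ⟨P1, P2, rfl⟩ := List.append_of_mem hv
  obtain ⟨c, m'⟩ := v
  simp only at hvc hw hle
  subst hvc
  refine (hb m' hw.1 hw.2 (by omega)).trans ?_
  rw [isAlignment_join] at h1
  obtain ⟨ha1, ha2⟩ := h1
  simp only at ha1 ha2 ⊢
  rw [pathCost_join, ENNReal.coe_add]
  have hin : ∀ i j, MateRel (A ++ X ++ B) i j → j < A.length + X.length → A.length ≤ j →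
      A.length ≤ i := by
    intro i j hij hj1 hj2
    obtain ⟨j, rfl⟩ := Nat.exists_eq_add_of_le hj2
    obtain ⟨i', rfl, -⟩ := mate_inside A B hX (by omega) (mate_symm hij)
    omega
  refine add_le_add ?_ ?_
  · refine iInf_le_of_le ⟨P1 ++ [(A.length, m')], ha1, ?_, ?_⟩ le_rfl
    · intro i j i' j' hij hi hj
      have hb1 := alignsAt_bounds ha1 hij
      have := h2 _ _ _ _ ((alignsAt_join _ _ _ _ _).2 (Or.inl hij)) hi hj
      rw [alignsAt_join] at this
      refine this.resolve_right fun hc => ?_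
      have hb2 := alignsAt_bounds ha2 hc
      have := hin _ _ hi hb2.2.1 hb2.1
      omega
    · intro p hp
      exact h3 p (by simp at hp ⊢; tauto)
  · refine iInf_le_of_le ⟨(A.length, m') :: P2, ha2, ?_, ?_⟩ le_rfl
    · intro i j i' j' hij hi hj
      have hb1 := alignsAt_bounds ha2 hij
      have := h2 _ _ _ _ ((alignsAt_join _ _ _ _ _).2 (Or.inr hij)) hi hj
      rw [alignsAt_join] at this
      refine this.resolve_left fun hc => ?_
      have hb2 := alignsAt_bounds ha1 hc
      have := hin _ _ (mate_symm hi) hb1.2.1 hb1.1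
      omega
    · intro p hp
      exact h3 p (by simp at hp ⊢; tauto)

theorem listPow_add {β : Type*} (R : List β) (a b : ℕ) :
    listPow R (a + b) = listPow R a ++ listPow R b := by
  induction a with
  | zero => simp [listPow]
  | succ a ih => rw [Nat.succ_add]; simp [listPow, ih]

theorem listPow_length {β : Type*} (R : List β) (a : ℕ) :
    (listPow R a).length = a * R.length := by
  induction a with
  | zero => simp [listPow]
  | succ a ih => simp [listPow, ih]; ring

theorem listPow_forest {R : List (Paren α)} (h : IsForest R) (a : ℕ) :
    IsForest (listPow R a) := by
  induction a with
  | zero => exact IsForest.nil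
  | succ a ih => exact IsForest.append h ih

theorem frag_occ {β : Type*} (l : List β) {i j : ℕ} (h : i ≤ j) (hj : j ≤ l.length) :
    ∃ A B, l = A ++ frag l i j ++ B ∧ A.length = i := by
  refine ⟨l.take i, l.drop j, ?_, by simp; omega⟩
  unfold frag
  have : l.take i = (l.take j).take i := by rw [List.take_take, min_eq_left h]
  rw [this, List.take_append_drop, List.take_append_drop]

theorem occ_sub {β : Type*} {l R : List β} {c E : ℕ}
    (h : ∃ A B, l = A ++ listPow R E ++ B ∧ A.length = c) {i m : ℕ} (him : i + m ≤ E) :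
    ∃ A B, l = A ++ listPow R m ++ B ∧ A.length = c + i * R.length := by
  obtain ⟨A, B, rfl, hA⟩ := h
  obtain ⟨d, rfl⟩ := Nat.exists_eq_add_of_le him
  refine ⟨A ++ listPow R i, listPow R d ++ B, ?_, ?_⟩
  · rw [listPow_add, listPow_add]; simp
  · simp [listPow_length, hA]

theorem block_eq (w : Option α → Option α → ℝ≥0) {F G R : List (Paren α)} (hR : IsForest R)
    {c d : ℕ} (hF : ∃ A B, F = A ++ listPow R 1 ++ B ∧ A.length = c)
    (hG : ∃ A B, G = A ++ listPow R 3 ++ B ∧ A.length = d) {y y' : ℕ} {i j : ℤ}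
    (hi : (y : ℤ) = d + R.length + i) (hj : (y' : ℤ) = d + 2 * R.length + j)
    (h1 : -(R.length : ℤ) ≤ i) (h2 : j ≤ R.length) (h3 : y ≤ y') :
    tedFrag w F G c (c + R.length) y y' = MR w R i j := by
  obtain ⟨A, B, rfl, rfl⟩ := hF
  obtain ⟨C, D, rfl, rfl⟩ := hG
  have e1 : listPow R 1 = R := by simp [listPow]
  unfold MR
  rw [if_pos (by omega), e1]
  have := ted_embed w A B C D hR (listPow_forest hR 3) (x := 0) (x' := R.length)
    (y := ((R.length : ℤ) + i).toNat) (y' := (2 * (R.length : ℤ) + j).toNat) le_rfl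
    (by rw [listPow_length]; omega)
  rw [← this]
  congr 1 <;> omega

theorem upper (w : Option α → Option α → ℝ≥0) {F G R : List (Paren α)} (hR : IsForest R)
    {lF lG pF pG E : ℕ} (hpF : R.length ≤ pF) (hpG : R.length ≤ pG)
    (hF : ∃ A B, F = A ++ listPow R (E + 2) ++ B ∧ A.length = pF - R.length)
    (hG : ∃ A B, G = A ++ listPow R (E + 2) ++ B ∧ A.length = pG - R.length) (pG' : ℕ) :
    ∀ e ≤ E, ∀ y : ℕ, (y : ℤ) ≤ pG + e * R.length + R.length →
      tedFrag w F G lF (pF + e * R.length) lG y ≤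
        tedFrag w F G lF pF lG pG' +
          mpPow R.length (MR w R) e ((pG' : ℤ) - pG) ((y : ℤ) - (pG + e * R.length)) := by
  intro e
  induction e with
  | zero =>
    intro _ y _
    simp only [mpPow]
    split_ifs with h
    · have : y = pG' := by push_cast at h; omega
      subst this
      simp
    · simp
  | succ e ih =>
    intro he y hy
    have key : ∀ j ∈ Finset.Icc (-(R.length : ℤ)) (R.length : ℤ),
        tedFrag w F G lF (pF + (e + 1) * R.length) lG y ≤
        tedFrag w F G lF pF lG pG' +
          (mpPow R.length (MR w R) e ((pG' : ℤ) - pG) j +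
            MR w R j ((y : ℤ) - (pG + (e + 1 : ℕ) * R.length))) := by
      intro j hj
      rw [Finset.mem_Icc] at hj
      push_cast at hy ⊢
      rw [← add_assoc]
      by_cases hc : (R.length : ℤ) + j ≤
          2 * (R.length : ℤ) + ((y : ℤ) - (pG + (e + 1) * R.length))
      · have hnn : (0 : ℤ) ≤ e * R.length := by positivity
        obtain ⟨m, hm⟩ := Int.eq_ofNat_of_zero_le (show 0 ≤ (pG : ℤ) + e * R.length + j by omega)
        refine (ted_concat w F G lF (pF + e * R.length) _ lG m y).trans ?_
        refine add_le_add ?_ ?_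
        · have := ih (by omega) m (by omega)
          rwa [show (m : ℤ) - (pG + e * R.length) = j by omega] at this
        · have oF := occ_sub hF (i := e + 1) (m := 1) (by omega)
          have oG := occ_sub hG (i := e) (m := 3) (by omega)
          have e1 : pF - R.length + (e + 1) * R.length = pF + e * R.length := by
            rw [add_mul]; omega
          have e2 : pF + (e + 1) * R.length = pF + e * R.length + R.length := by ring
          rw [e1] at oF
          rw [e2]
          refine (block_eq w hR oF oG ?_ ?_ ?_ ?_ ?_).le
          · push_cast [hpG]; omega
          · push_cast [hpG]; ring
          · omega
          · linarith
          · zify; linarith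
      · unfold MR
        rw [if_neg hc]
        simp
    simp only [mpPow, minplus]
    obtain ⟨j, hj, hj'⟩ := Finset.exists_mem_eq_inf (Finset.Icc (-(R.length : ℤ)) (R.length : ℤ))
      ⟨0, by simp⟩ (fun j => mpPow R.length (MR w R) e ((pG' : ℤ) - pG) j +
            MR w R j ((y : ℤ) - (pG + (e + 1 : ℕ) * R.length)))
    rw [hj']
    exact key j hj

theorem lower (k : ℕ) (w : Option α → Option α → ℝ≥0) {F G R : List (Paren α)}
    (hR : IsForest R) {lF lG pF pG E : ℕ} (hpF : R.length ≤ pF) (hpG : R.length ≤ pG)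
    (hk : 4 * k ≤ R.length) (hl : lF ≤ pF)
    (h1 : pF ≤ pG + 2 * k) (h2 : pG ≤ pF + 2 * k)
    (hF : ∃ A B, F = A ++ listPow R (E + 2) ++ B ∧ A.length = pF - R.length)
    (hG : ∃ A B, G = A ++ listPow R (E + 2) ++ B ∧ A.length = pG - R.length) :
    ∀ e ≤ E, ∀ y : ℕ, pF + e * R.length ≤ y + 2 * k → y ≤ pF + e * R.length + 2 * k →
      (Finset.Icc (pG - R.length) (pG + R.length)).inf (fun pG' =>
        btedFrag k w F G lF pF lG pG' +
          mpPow R.length (MR w R) e ((pG' : ℤ) - pG) ((y : ℤ) - (pG + e * R.length))) ≤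
      btedFrag k w F G lF (pF + e * R.length) lG y := by
  intro e
  induction e with
  | zero =>
    intro _ y hy1 hy2
    refine (Finset.inf_le (b := y) (by rw [Finset.mem_Icc]; omega)).trans ?_
    simp [mpPow]
  | succ e ih =>
    intro he y hy1 hy2
    have oF := occ_sub hF (i := e + 1) (m := 1) (by omega)
    have oG := occ_sub hG (i := e) (m := 3) (by omega)
    have e1 : pF - R.length + (e + 1) * R.length = pF + e * R.length := by
      rw [add_mul]; omega
    have e2 : pF + (e + 1) * R.length = pF + e * R.length + R.length := by ring
    rw [e1] at oF
    rw [e2] at hy1 hy2 ⊢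
    obtain ⟨A, B, hFe, hA⟩ := id oF
    have e3 : listPow R 1 = R := by simp [listPow]
    rw [e3] at hFe
    have hsplit := bted_split k w A B hR G (f := lF) (g := lG) (g' := y) (by rw [hA]; omega)
    rw [← hFe, hA] at hsplit
    apply hsplit
    intro m hm1 hm2 hm3
    have hblock : MR w R ((m : ℤ) - (pG + e * R.length)) ((y : ℤ) - (pG + (e + 1 : ℕ) * R.length))
        ≤ btedFrag k w F G (pF + e * R.length) (pF + e * R.length + R.length) m y := by
      refine le_trans ?_ (ted_le_bted k w F G _ _ _ _)
      zify at hy1 hy2 hm1 hm2 hm3 h1 h2 hk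
      refine (block_eq w hR oF oG ?_ ?_ ?_ ?_ ?_).ge
      · push_cast [hpG]; ring
      · push_cast [hpG]; ring
      · omega
      · push_cast; linarith
      · zify; exact hm3
    obtain ⟨p, hp, hp'⟩ := Finset.exists_mem_eq_inf (Finset.Icc (pG - R.length) (pG + R.length))
      ⟨pG, by simp⟩ (fun pG' => btedFrag k w F G lF pF lG pG' +
          mpPow R.length (MR w R) e ((pG' : ℤ) - pG) ((m : ℤ) - (pG + e * R.length)))
    have := ih (by omega) m hm1 hm2
    rw [hp'] at this
    refine (Finset.inf_le hp).trans ?_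
    refine le_trans ?_ (add_le_add this hblock)
    rw [add_assoc]
    refine add_le_add le_rfl ?_
    simp only [mpPow, minplus]
    refine Finset.inf_le (f := fun j => mpPow R.length (MR w R) e ((p : ℤ) - pG) j +
      MR w R j ((y : ℤ) - (pG + (e + 1 : ℕ) * R.length))) ?_
    rw [Finset.mem_Icc]
    zify at *
    constructor <;> omega

theorem q_eq {β : Type*} {l R : List β} {p q e : ℕ} (hR : 0 < R.length) (hp : R.length ≤ p)
    (hq : q + R.length ≤ l.length)
    (h : frag l (p - R.length) (q + R.length) = listPow R (e + 2)) :
    q = p + e * R.length := by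
  have := congrArg List.length h
  rw [listPow_length] at this
  simp only [frag, List.length_drop, List.length_take, min_eq_left hq, add_mul] at this
  have : 0 ≤ e * R.length := Nat.zero_le _
  omega

end TedAux

/-- Lemma 4.4: in the free-pair setting, with
`F[p_F..q_F) = G[p_G..q_G) = R^e` a free pair such that `F[p_F..q_F)` is a suffix
of `F[l_F..r_F)` and `|r_F − r_G| ≤ 2k`, the bounded tree edit distance of the
fragments is sandwiched by min-plus combinations with the matrix power `M_R^e`.
-/
theorem ted_matrix_update {α : Type*}
    (w : Option α → Option α → ℝ≥0) (hw : Normalized w)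
    (k : ℕ) (hk : 0 < k)
    (F G : List (Paren α)) (hF : IsForest F) (hG : IsForest G)
    (lF rF lG rG pF qF pG qG : ℕ) (R : List (Paren α)) (e : ℕ)
    (hrFG : rF ≤ rG + 2 * k) (hrGF : rG ≤ rF + 2 * k)
    (hsuf1 : lF ≤ pF) (hsuf2 : qF = rF)
    (hpFG : pF ≤ pG + 2 * k) (hpGF : pG ≤ pF + 2 * k)
    (hR : IsForest R) (hRlen : 4 * k ≤ R.length) (hRlen' : R.length < 8 * k)
    (he : 0 < e)
    (hpFR : R.length ≤ pF) (hpGR : R.length ≤ pG)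
    (hqF : qF + R.length ≤ F.length) (hqG : qG + R.length ≤ G.length)
    (hoccF : frag F (pF - R.length) (qF + R.length) = listPow R (e + 2))
    (hoccG : frag G (pG - R.length) (qG + R.length) = listPow R (e + 2)) :
    btedFrag k w F G lF rF lG rG ≥
      (Finset.Icc (pG - R.length) (pG + R.length)).inf (fun pG' =>
        btedFrag k w F G lF pF lG pG' +
          mpPow R.length (MR w R) e ((pG' : ℤ) - (pG : ℤ)) ((rG : ℤ) - (qG : ℤ))) ∧
    (Finset.Icc (pG - R.length) (pG + R.length)).inf (fun pG' =>
        btedFrag k w F G lF pF lG pG' +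
          mpPow R.length (MR w R) e ((pG' : ℤ) - (pG : ℤ)) ((rG : ℤ) - (qG : ℤ))) ≥
      (Finset.Icc (pG - R.length) (pG + R.length)).inf (fun pG' =>
        tedFrag w F G lF pF lG pG' +
          mpPow R.length (MR w R) e ((pG' : ℤ) - (pG : ℤ)) ((rG : ℤ) - (qG : ℤ))) ∧
    (Finset.Icc (pG - R.length) (pG + R.length)).inf (fun pG' =>
        tedFrag w F G lF pF lG pG' +
          mpPow R.length (MR w R) e ((pG' : ℤ) - (pG : ℤ)) ((rG : ℤ) - (qG : ℤ))) ≥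
      tedFrag w F G lF rF lG rG := by
  subst hsuf2
  have hn : 0 < R.length := by omega
  have hqF' := TedAux.q_eq hn hpFR hqF hoccF
  have hqG' := TedAux.q_eq hn hpGR hqG hoccG
  have oF : ∃ A B, F = A ++ listPow R (e + 2) ++ B ∧ A.length = pF - R.length := by
    have := TedAux.frag_occ F (i := pF - R.length) (j := qF + R.length) (by omega) hqF
    rwa [hoccF] at this
  have oG : ∃ A B, G = A ++ listPow R (e + 2) ++ B ∧ A.length = pG - R.length := by
    have := TedAux.frag_occ G (i := pG - R.length) (j := qG + R.length) (by omega) hqG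
    rwa [hoccG] at this
  have hcast : (qG : ℤ) = pG + e * R.length := by rw [hqG']; push_cast; ring
  refine ⟨?_, ?_, ?_⟩
  · have := TedAux.lower k w hR (lF := lF) (lG := lG) hpFR hpGR hRlen hsuf1 hpFG hpGF oF oG e le_rfl
      rG (by omega) (by omega)
    rw [← hqF', ← hcast] at this
    exact this
  · apply Finset.inf_mono_fun
    intro p _
    exact add_le_add (TedAux.ted_le_bted k w F G _ _ _ _) le_rfl
  · apply Finset.le_inf
    intro p _
    have := TedAux.upper w hR (lF := lF) (lG := lG) hpFR hpGR oF oG p e le_rfl rG (by omega)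
    rw [← hqF', ← hcast] at this
    exact this
end

section
/- Under the hypotheses of the free-pair setting—fragments F[l_F..r_F), G[l_G..r_G) of forests F, G ∈ F_Σ, a normalized weight function w, a threshold k ∈ ℤ+, and a free pair F[p_F..q_F) = G[p_G..q_G) = R^e with F[p_F..q_F) a suffix of F[l_F..r_F)—set x_t = p_F + |R|·t and y_t = p_G + |R|·t for t ∈ [0..e]. Then for every t ∈ [0..e) and every z_{t+1} ∈ [y_{t+1}−|R|..y_{t+1}+|R|]: bted_k^w(F[l_F..x_{t+1}), G[l_G..z_{t+1})) ≥ min over z_t ∈ [y_t−|R|..y_t+|R|] of (bted_k^w(F[l_F..x_t), G[l_G..z_t)) + M_R[z_t−y_t, z_{t+1}−y_{t+1}]) ≥ min over z_t ∈ [y_t−|R|..y_t+|R|] of (ted^w(F[l_F..x_t), G[l_G..z_t)) + M_R[z_t−y_t, z_{t+1}−y_{t+1}]) ≥ ted^w(F[l_F..x_{t+1}), G[l_G..z_{t+1})). -/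
open scoped NNReal ENNReal

attribute [local instance] Classical.propDecidable

namespace TedStep

/-- Height: number of opening minus number of closing parentheses. -/
def hgt {α : Type*} (l : List (Paren α)) : ℤ :=
  (l.map (fun c => if c.1 = true then (1 : ℤ) else -1)).sum

lemma hgt_append {α : Type*} (l m : List (Paren α)) : hgt (l ++ m) = hgt l + hgt m := by
  simp [hgt]

lemma forest_hgt {α : Type*} {B : List (Paren α)} (h : IsForest B) :
    hgt B = 0 ∧ ∀ s r, B = s ++ r → 0 ≤ hgt s := by
  induction h with
  | nil =>
    refine ⟨by simp [hgt], ?_⟩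
    intro s r h
    have : s = [] := by
      have := congrArg List.length h
      simp at this
      exact List.length_eq_zero_iff.1 (by omega)
    simp [this, hgt]
  | @append F G _ _ ihF ihG =>
    refine ⟨by rw [hgt_append]; omega, ?_⟩
    intro s r h
    rcases List.append_eq_append_iff.1 h with ⟨a, h1, h2⟩ | ⟨a, h1, h2⟩
    · subst h1
      rw [hgt_append, ihF.1]
      have := ihG.2 a r h2
      omega
    · exact ihF.2 s a h1
  | @wrap F a _ ih =>
    have e1 : hgt [((true, a) : Paren α)] = 1 := by simp [hgt]
    have e2 : hgt [((false, a) : Paren α)] = -1 := by simp [hgt]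
    have e3 : (true, a) :: F ++ [(false, a)] = [(true, a)] ++ (F ++ [(false, a)]) := by simp
    refine ⟨by rw [e3, hgt_append, hgt_append]; omega, ?_⟩
    intro s r h
    rw [e3] at h
    cases s with
    | nil => simp [hgt]
    | cons c s =>
      simp only [List.cons_append, List.nil_append, List.cons.injEq] at h
      obtain ⟨rfl, h⟩ := h
      have e4 : hgt ((true, a) :: s) = 1 + hgt s := by
        rw [← e1, ← hgt_append]; rfl
      rw [e4]
      rcases List.append_eq_append_iff.1 h with ⟨b, h1, h2⟩ | ⟨b, h1, h2⟩
      · subst h1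
        rw [hgt_append, ih.1]
        rcases List.singleton_eq_append_iff.1 h2 with ⟨rfl, _⟩ | ⟨rfl, _⟩
        · simp [hgt]
        · omega
      · have := ih.2 s b h1
        omega

lemma forest_suffix {α : Type*} {B : List (Paren α)} (h : IsForest B) {s r : List (Paren α)}
    (e : B = s ++ r) : hgt r ≤ 0 := by
  have h1 := (forest_hgt h).1
  have h2 := (forest_hgt h).2 s r e
  rw [e, hgt_append] at h1
  omega

/-- `B` occurs in `F` at position `a`. -/
def Occ {β : Type*} (F : List β) (a : ℕ) (B : List β) : Prop :=
  ∀ i, i < B.length → F[a + i]? = B[i]?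

lemma getElem?_frag {β : Type*} (l : List β) (i j m : ℕ) :
    (frag l i j)[m]? = if i + m < j then l[i + m]? else none := by
  simp [frag, List.getElem?_drop, List.getElem?_take]

lemma occ_len {β : Type*} {F : List β} {a : ℕ} {B : List β} (h : Occ F a B) {i : ℕ}
    (hi : i < B.length) : a + i < F.length := by
  have := h i hi
  rw [List.getElem?_eq_getElem hi] at this
  exact (List.getElem?_eq_some_iff.1 this).1

lemma occ_frag {β : Type*} {F : List β} {a : ℕ} {B : List β} (h : Occ F a B) {i j : ℕ}
    (hj : j ≤ B.length) : frag F (a + i) (a + j) = frag B i j := by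
  apply List.ext_getElem?
  intro m
  rw [getElem?_frag, getElem?_frag]
  by_cases hm : i + m < j
  · rw [if_pos (by omega), if_pos hm, add_assoc, h _ (by omega)]
  · rw [if_neg (by omega), if_neg hm]

lemma occ_node {α : Type*} {F B : List (Paren α)} {a : ℕ} (h : Occ F a B) {i j : ℕ}
    (hj : j < B.length) : IsNode F (a + i) (a + j) ↔ IsNode B i j := by
  unfold IsNode
  by_cases hij : i < j
  · rw [add_assoc, occ_frag h hj.le, h i (by omega), h j hj]
    have := occ_len h hj
    constructor
    · rintro ⟨_, _, h3⟩; exact ⟨hij, hj, h3⟩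
    · rintro ⟨_, _, h3⟩; exact ⟨by omega, this, h3⟩
  · constructor
    · rintro ⟨h, _⟩; omega
    · rintro ⟨h, _⟩; omega

lemma occ_mate {α : Type*} {F B : List (Paren α)} {a : ℕ} (h : Occ F a B) {i j : ℕ}
    (hi : i < B.length)
    (hj : j < B.length) : MateRel F (a + i) (a + j) ↔ MateRel B i j := by
  unfold MateRel
  rw [occ_node h hj, occ_node h hi]

lemma frag_split {β : Type*} (l : List β) {i j m : ℕ} (h1 : i ≤ j) (h2 : j ≤ m) (h3 : m ≤ l.length) :
    frag l i m = frag l i j ++ frag l j m := by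
  apply List.ext_getElem?
  intro n
  have hl : (frag l i j).length = j - i := by simp [frag]; omega
  rw [List.getElem?_append, getElem?_frag, getElem?_frag, getElem?_frag, hl]
  split_ifs <;> first | rfl | omega | (congr 1; omega)

lemma frag_self {β : Type*} (l : List β) : frag l 0 l.length = l := by simp [frag]

lemma frag_one {β : Type*} (l : List β) (i : ℕ) (c : β) (h : l[i]? = some c) :
    frag l i (i+1) = [c] := by
  apply List.ext_getElem?
  intro n
  rw [getElem?_frag]
  cases n with
  | zero => simp [h]
  | succ n => simp

lemma node_right {α : Type*} {F B : List (Paren α)} {a : ℕ} (h : Occ F a B) (hB : IsForest B)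
    {i j : ℕ} (hi : a ≤ i) (hi' : i < a + B.length) (hn : IsNode F i j) :
    j < a + B.length := by
  by_contra hj
  obtain ⟨i, rfl⟩ := Nat.exists_eq_add_of_le hi
  obtain ⟨h1, h2, ⟨c, h3, _⟩, h5⟩ := hn
  have hi : i < B.length := by omega
  rw [h i hi] at h3
  have e : frag F (a + i + 1) j = frag F (a + i + 1) (a + B.length) ++ frag F (a + B.length) j :=
    frag_split F (by omega) (by omega) (by omega)
  have k1 := (forest_hgt h5).2 _ _ e
  rw [add_assoc, occ_frag h le_rfl] at k1
  have e2 : frag B 0 B.length = frag B 0 i ++ frag B i B.length :=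
    frag_split B (by omega) (by omega) (by omega)
  have e3 : frag B i B.length = frag B i (i+1) ++ frag B (i+1) B.length :=
    frag_split B (by omega) (by omega) (by omega)
  rw [frag_self] at e2
  have k2 := (forest_hgt hB).2 _ _ e2
  have k3 := (forest_hgt hB).1
  rw [e2, hgt_append, e3, hgt_append, frag_one _ _ _ h3] at k3
  have e1 : hgt [((true, c) : Paren α)] = 1 := by simp [hgt]
  omega

lemma node_left {α : Type*} {F B : List (Paren α)} {a : ℕ} (h : Occ F a B) (hB : IsForest B)
    {i j : ℕ} (hi : a ≤ j) (hi' : j < a + B.length) (hn : IsNode F i j) :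
    a ≤ i := by
  by_contra hj
  obtain ⟨j, rfl⟩ := Nat.exists_eq_add_of_le hi
  obtain ⟨h1, h2, ⟨c, _, h3⟩, h5⟩ := hn
  have hi : j < B.length := by omega
  rw [h j hi] at h3
  have e : frag F (i + 1) (a + j) = frag F (i + 1) (a + 0) ++ frag F (a + 0) (a + j) :=
    frag_split F (by omega) (by omega) (by omega)
  have k1 := forest_suffix h5 e
  rw [occ_frag h (by omega)] at k1
  have e2 : frag B 0 B.length = frag B 0 (j+1) ++ frag B (j+1) B.length :=
    frag_split B (by omega) (by omega) (by omega)
  have e3 : frag B 0 (j+1) = frag B 0 j ++ frag B j (j+1) :=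
    frag_split B (by omega) (by omega) (by omega)
  rw [frag_self] at e2
  have k2 := (forest_hgt hB).2 _ _ e2
  rw [e3, hgt_append, frag_one _ _ _ h3] at k2
  have e1 : hgt [((false, c) : Paren α)] = -1 := by simp [hgt]
  omega

lemma mate_in {α : Type*} {F B : List (Paren α)} {a : ℕ} (h : Occ F a B) (hB : IsForest B)
    {i j : ℕ} (hi : a ≤ i) (hi' : i < a + B.length) (hn : MateRel F i j) :
    a ≤ j ∧ j < a + B.length := by
  rcases hn with hn | hn
  · have := node_right h hB hi hi' hn
    have := hn.1
    omega
  · have := node_left h hB hi hi' hn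
    have := hn.1
    omega

lemma mate_symm {α : Type*} {F : List (Paren α)} {i j : ℕ} (h : MateRel F i j) :
    MateRel F j i := h.symm

/-! ### Paths -/

lemma align_cons (x x' y y' : ℕ) (p q : ℕ × ℕ) (r : List (ℕ × ℕ)) :
    IsAlignment x x' y y' (p :: q :: r) ↔
      p = (x, y) ∧ AlignStep p q ∧ IsAlignment q.1 x' q.2 y' (q :: r) := by
  unfold IsAlignment
  have hc : (p :: q :: r).Chain' AlignStep ↔ AlignStep p q ∧ (q :: r).Chain' AlignStep :=
    List.isChain_cons_cons
  rw [hc]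
  simp [List.getLast?_cons_cons]
  tauto

lemma align_single (x x' y y' : ℕ) (p : ℕ × ℕ) :
    IsAlignment x x' y y' [p] ↔ p = (x, y) ∧ p = (x', y') := by
  have hc : [p].Chain' AlignStep := List.isChain_singleton p
  simp [IsAlignment, hc]

lemma align_nil (x x' y y' : ℕ) : ¬ IsAlignment x x' y y' [] := by
  simp [IsAlignment]

lemma step_le {p q : ℕ × ℕ} (h : AlignStep p q) :
    p.1 ≤ q.1 ∧ p.2 ≤ q.2 ∧ q.1 ≤ p.1 + 1 ∧ q.2 ≤ p.2 + 1 := by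
  rcases h with rfl | rfl | rfl <;> simp

lemma alignsAt_cons (p q : ℕ × ℕ) (r : List (ℕ × ℕ)) (f g : ℕ) :
    AlignsAt (p :: q :: r) f g ↔ (p = (f, g) ∧ q = (f + 1, g + 1)) ∨ AlignsAt (q :: r) f g := by
  unfold AlignsAt
  constructor
  · rintro ⟨t, h1, h2⟩
    cases t with
    | zero => left; simpa using And.intro h1 h2
    | succ t => right; exact ⟨t, by simpa using h1, by simpa using h2⟩
  · rintro (⟨rfl, rfl⟩ | ⟨t, h1, h2⟩)
    · exact ⟨0, by simp, by simp⟩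
    · exact ⟨t + 1, by simpa using h1, by simpa using h2⟩

lemma alignsAt_single (p : ℕ × ℕ) (f g : ℕ) : ¬ AlignsAt [p] f g := by
  rintro ⟨t, h1, h2⟩
  simp at h2

lemma align_bounds {x' y' : ℕ} (p : List (ℕ × ℕ)) : ∀ {x y : ℕ}, IsAlignment x x' y y' p →
    x ≤ x' ∧ y ≤ y' ∧ (∀ v ∈ p, x ≤ v.1 ∧ v.1 ≤ x' ∧ y ≤ v.2 ∧ v.2 ≤ y') ∧
    ∀ f g, AlignsAt p f g → x ≤ f ∧ f < x' ∧ y ≤ g ∧ g < y' := by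
  induction p with
  | nil => intro x y h; exact absurd h (align_nil _ _ _ _)
  | cons p r ih =>
    intro x y h
    cases r with
    | nil =>
      rw [align_single] at h
      obtain ⟨rfl, h⟩ := h
      simp only [Prod.mk.injEq] at h
      obtain ⟨rfl, rfl⟩ := h
      refine ⟨le_rfl, le_rfl, by simp, ?_⟩
      intro f g h; exact absurd h (alignsAt_single _ _ _)
    | cons q r =>
      rw [align_cons] at h
      obtain ⟨rfl, hs, h⟩ := h
      obtain ⟨i1, i2, i3, i4⟩ := ih h
      have hs' := step_le hs
      simp only at hs'
      refine ⟨by omega, by omega, ?_, ?_⟩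
      · intro v hv
        rcases List.mem_cons.1 hv with rfl | hv
        · simp only; omega
        · have := i3 v hv; omega
      · intro f g hfg
        rw [alignsAt_cons] at hfg
        rcases hfg with ⟨e1, e2⟩ | hfg
        · simp only [Prod.mk.injEq] at e1
          subst e2
          simp only at *
          omega
        · have := i4 f g hfg; omega

lemma align_hits {x' y' : ℕ} (p : List (ℕ × ℕ)) : ∀ {x y m : ℕ}, IsAlignment x x' y y' p →
    x ≤ m → m ≤ x' → ∃ s v r, p = s ++ v :: r ∧ v.1 = m := by
  induction p with
  | nil => intro x y m h; exact absurd h (align_nil _ _ _ _)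
  | cons p r ih =>
    intro x y m h h1 h2
    by_cases hxm : x = m
    · have : p.1 = x := by
        have := h.1
        simp at this
        rw [this]
      exact ⟨[], p, r, rfl, by omega⟩
    · cases r with
      | nil =>
        rw [align_single] at h
        obtain ⟨rfl, h⟩ := h
        simp only [Prod.mk.injEq] at h
        omega
      | cons q r =>
        rw [align_cons] at h
        obtain ⟨rfl, hs, h⟩ := h
        have hs' := step_le hs
        simp only at hs'
        obtain ⟨s, v, r', e, hv⟩ := ih (m := m) h (by omega) h2
        exact ⟨(x, y) :: s, v, r', by simp [e], hv⟩

lemma align_append {x' y' : ℕ} (s : List (ℕ × ℕ)) (v : ℕ × ℕ) (r : List (ℕ × ℕ)) : ∀ {x y : ℕ},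
    IsAlignment x x' y y' (s ++ v :: r) ↔
      IsAlignment x v.1 y v.2 (s ++ [v]) ∧ IsAlignment v.1 x' v.2 y' (v :: r) := by
  induction s with
  | nil =>
    intro x y
    simp only [List.nil_append]
    rw [align_single]
    constructor
    · intro h
      have : v = (x, y) := by simpa using h.1
      subst this
      exact ⟨⟨rfl, rfl⟩, h⟩
    · rintro ⟨⟨rfl, _⟩, h⟩
      exact h
  | cons p s ih =>
    intro x y
    cases s with
    | nil =>
      simp only [List.cons_append, List.nil_append, align_cons, align_single]
      tauto
    | cons q s =>
      simp only [List.cons_append] at ih ⊢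
      rw [align_cons, align_cons, ih]
      tauto

lemma alignsAt_append (s : List (ℕ × ℕ)) (v : ℕ × ℕ) (r : List (ℕ × ℕ)) (f g : ℕ) :
    AlignsAt (s ++ v :: r) f g ↔ AlignsAt (s ++ [v]) f g ∨ AlignsAt (v :: r) f g := by
  induction s with
  | nil => simp [alignsAt_single]
  | cons p s ih =>
    cases s with
    | nil =>
      simp only [List.cons_append, List.nil_append, alignsAt_cons]
      have := alignsAt_single v f g
      tauto
    | cons q s =>
      simp only [List.cons_append] at ih ⊢
      rw [alignsAt_cons, alignsAt_cons, ih]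
      tauto

lemma cost_append {α : Type*} (w : Option α → Option α → ℝ≥0) (F G : List (Paren α))
    (s : List (ℕ × ℕ)) (v : ℕ × ℕ) (r : List (ℕ × ℕ)) :
    pathCost w F G (s ++ v :: r) = pathCost w F G (s ++ [v]) + pathCost w F G (v :: r) := by
  induction s with
  | nil => simp [pathCost]
  | cons p s ih =>
    cases s with
    | nil => simp [pathCost]
    | cons q s =>
      simp only [List.cons_append] at ih ⊢
      rw [pathCost, pathCost, ih]
      ring

/-- Translation of vertices. -/
def sh (a b : ℕ) (v : ℕ × ℕ) : ℕ × ℕ := (a + v.1, b + v.2)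

lemma step_sh (a b : ℕ) (p q : ℕ × ℕ) : AlignStep (sh a b p) (sh a b q) ↔ AlignStep p q := by
  obtain ⟨p1, p2⟩ := p
  obtain ⟨q1, q2⟩ := q
  simp only [AlignStep, sh, Prod.mk.injEq]
  omega

lemma align_sh (a b : ℕ) {x' y' : ℕ} (p : List (ℕ × ℕ)) : ∀ {x y : ℕ},
    IsAlignment (a + x) (a + x') (b + y) (b + y') (p.map (sh a b)) ↔
    IsAlignment x x' y y' p := by
  induction p with
  | nil => intro x y; simp [align_nil]
  | cons p r ih =>
    intro x y
    cases r with
    | nil =>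
      obtain ⟨p1, p2⟩ := p
      simp only [List.map_cons, List.map_nil, align_single, sh, Prod.mk.injEq]
      omega
    | cons q r =>
      simp only [List.map_cons] at ih ⊢
      rw [align_cons, align_cons, step_sh, ← ih]
      obtain ⟨p1, p2⟩ := p
      simp [sh]

lemma alignsAt_sh (a b : ℕ) (p : List (ℕ × ℕ)) (f g : ℕ) :
    AlignsAt (p.map (sh a b)) (a + f) (b + g) ↔ AlignsAt p f g := by
  induction p with
  | nil => simp [AlignsAt]
  | cons p r ih =>
    cases r with
    | nil => simp [alignsAt_single]
    | cons q r =>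
      simp only [List.map_cons] at ih ⊢
      rw [alignsAt_cons, alignsAt_cons, ih]
      obtain ⟨p1, p2⟩ := p
      obtain ⟨q1, q2⟩ := q
      simp only [sh, Prod.mk.injEq, add_assoc, add_right_inj]

lemma occ_lbl {α : Type*} {F B : List (Paren α)} {a : ℕ} (h : Occ F a B) {i : ℕ}
    (hi : i < B.length) : lbl F (a + i) = lbl B i := by
  simp [lbl, h i hi]

lemma cost_sh {α : Type*} (w : Option α → Option α → ℝ≥0) {F G B C : List (Paren α)} {a b : ℕ}
    (hF : Occ F a B) (hG : Occ G b C) {x' y' : ℕ} (hx : x' ≤ B.length) (hy : y' ≤ C.length)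
    (p : List (ℕ × ℕ)) : ∀ {x y : ℕ}, IsAlignment x x' y y' p →
    pathCost w F G (p.map (sh a b)) = pathCost w B C p := by
  induction p with
  | nil => intro x y h; rfl
  | cons p r ih =>
    intro x y h
    cases r with
    | nil => rfl
    | cons q r =>
      rw [align_cons] at h
      obtain ⟨rfl, hs, h⟩ := h
      have hb := align_bounds _ h
      have := ih h
      simp only [List.map_cons] at this ⊢
      rw [pathCost, pathCost, this]
      congr 1
      rcases hs with rfl | rfl | rfl
      · simp only at hb
        simp [sh, occ_lbl hF (show x < B.length by omega), add_assoc]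
      · simp only at hb
        simp [sh, occ_lbl hG (show y < C.length by omega), add_assoc]
      · simp only at hb
        simp [sh, occ_lbl hF (show x < B.length by omega),
          occ_lbl hG (show y < C.length by omega), add_assoc]

lemma unshift (a b : ℕ) (p : List (ℕ × ℕ)) (h : ∀ v ∈ p, a ≤ v.1 ∧ b ≤ v.2) :
    ∃ q : List (ℕ × ℕ), p = q.map (sh a b) := by
  refine ⟨p.map (fun v => (v.1 - a, v.2 - b)), ?_⟩
  rw [List.map_map]
  conv_lhs => rw [← List.map_id p]
  apply List.map_congr_left
  intro v hv
  have := h v hv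
  ext <;> simp only [Function.comp, sh, id] <;> omega

lemma listPow_length {β : Type*} (R : List β) (e : ℕ) : (listPow R e).length = e * R.length := by
  induction e with
  | zero => simp [listPow]
  | succ e ih => simp [listPow, ih]; ring

lemma listPow_forest {α : Type*} {R : List (Paren α)} (h : IsForest R) (e : ℕ) :
    IsForest (listPow R e) := by
  induction e with
  | zero => exact IsForest.nil
  | succ e ih => exact IsForest.append h ih

lemma listPow_add {β : Type*} (R : List β) (m n : ℕ) :
    listPow R (m + n) = listPow R m ++ listPow R n := by
  induction m with
  | zero => simp [listPow]
  | succ m ih => rw [Nat.succ_add, listPow, ih, listPow, List.append_assoc]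

/-- Sub-occurrences of powers. -/
lemma occ_pow {β : Type*} {F R : List β} {a b N : ℕ} (h : frag F a b = listPow R N)
    {m n : ℕ} (hmn : m + n ≤ N) : Occ F (a + m * R.length) (listPow R n) := by
  intro i hi
  obtain ⟨c, rfl⟩ := Nat.exists_eq_add_of_le hmn
  have h1 : (listPow R (m + n + c))[m * R.length + i]? = (listPow R n)[i]? := by
    rw [listPow_add, listPow_add, List.append_assoc, List.getElem?_append_right
      (by rw [listPow_length]; omega), listPow_length, Nat.add_sub_cancel_left,
      List.getElem?_append_left hi]
  rw [← h, getElem?_frag] at h1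
  split_ifs at h1 with h2
  · rw [← h1, add_assoc]
  · rw [List.getElem?_eq_getElem hi] at h1
    cases h1

/-- Splitting off / gluing a block. -/
lemma consistent_glue {α : Type*} {F G B C : List (Paren α)} {a b : ℕ}
    (hB : IsForest B) (hC : IsForest C) (hF : Occ F a B) (hG : Occ G b C)
    {x y zt z' : ℕ} {s r : List (ℕ × ℕ)} {v : ℕ × ℕ} {q : List (ℕ × ℕ)}
    (hq : v :: r = q.map (sh a b)) (hv : v.1 = a)
    (h1 : IsAlignment x v.1 y v.2 (s ++ [v]))
    (h2 : IsAlignment 0 B.length zt z' q) (hz' : z' ≤ C.length) :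
    Consistent F G (s ++ v :: r) ↔ Consistent F G (s ++ [v]) ∧ Consistent B C q := by
  have b1 := (align_bounds _ h1).2.2.2
  have b2 := (align_bounds _ h2).2.2.2
  have b3 : ∀ f g, AlignsAt (v :: r) f g → ∃ f0 g0, f = a + f0 ∧ g = b + g0 ∧ AlignsAt q f0 g0 := by
    intro f g h
    have : IsAlignment (a + 0) (a + B.length) (b + zt) (b + z') (v :: r) := by
      rw [hq, align_sh]; exact h2
    have := (align_bounds _ this).2.2.2 f g h
    obtain ⟨f0, rfl⟩ := Nat.exists_eq_add_of_le (show a ≤ f by omega)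
    obtain ⟨g0, rfl⟩ := Nat.exists_eq_add_of_le (show b ≤ g by omega)
    exact ⟨f0, g0, rfl, rfl, by rwa [hq, alignsAt_sh] at h⟩
  constructor
  · intro h
    constructor
    · intro f g f' g' hA hf hg
      have := h f g f' g' ((alignsAt_append _ _ _ _ _).2 (Or.inl hA)) hf hg
      rcases (alignsAt_append _ _ _ _ _).1 this with h' | h'
      · exact h'
      · exfalso
        obtain ⟨f0, g0, rfl, rfl, h0⟩ := b3 _ _ h'
        have k1 := b2 _ _ h0
        have k2 := b1 _ _ hA
        have := mate_in hF hB (by omega) (by omega) hf.symm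
        omega
    · intro f g f' g' hA hf hg
      have k1 := b2 _ _ hA
      have hf' : f' < B.length := by
        rcases hf with h | h
        · exact h.2.1
        · exact lt_trans h.1 h.2.1
      have hg' : g' < C.length := by
        rcases hg with h | h
        · exact h.2.1
        · exact lt_trans h.1 h.2.1
      have := h (a + f) (b + g) (a + f') (b + g')
        ((alignsAt_append _ _ _ _ _).2 (Or.inr (by rw [hq, alignsAt_sh]; exact hA)))
        ((occ_mate hF (by omega) hf').2 hf) ((occ_mate hG (by omega) hg').2 hg)
      rcases (alignsAt_append _ _ _ _ _).1 this with h' | h'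
      · have := b1 _ _ h'
        omega
      · rwa [hq, alignsAt_sh] at h'
  · rintro ⟨c1, c2⟩ f g f' g' hA hf hg
    rw [alignsAt_append] at hA ⊢
    rcases hA with hA | hA
    · exact Or.inl (c1 _ _ _ _ hA hf hg)
    · right
      obtain ⟨f0, g0, rfl, rfl, h0⟩ := b3 _ _ hA
      have k1 := b2 _ _ h0
      have m1 := mate_in hF hB (by omega) (by omega) hf
      have m2 := mate_in hG hC (by omega) (by omega) hg
      obtain ⟨f1, rfl⟩ := Nat.exists_eq_add_of_le m1.1
      obtain ⟨g1, rfl⟩ := Nat.exists_eq_add_of_le m2.1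
      rw [occ_mate hF (by omega) (by omega)] at hf
      rw [occ_mate hG (by omega) (by omega)] at hg
      rw [hq, alignsAt_sh]
      exact c2 _ _ _ _ h0 hf hg

/-- First inequality, abstractly. -/
lemma split_bound {α : Type*} (w : Option α → Option α → ℝ≥0) (k : ℕ)
    {F G B C : List (Paren α)} {a b : ℕ}
    (hB : IsForest B) (hC : IsForest C) (hF : Occ F a B) (hG : Occ G b C)
    {lF lG lo hi z' : ℕ} (hl : lF ≤ a) (hz' : z' ≤ C.length)
    (hlo : b ≤ lo) (hlo' : lo + 2 * k ≤ a) (hhi : a + 2 * k ≤ hi)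
    (M : ℕ → ℝ≥0∞)
    (hM : ∀ zt, b + zt ≤ hi → zt ≤ z' → M (b + zt) = tedFrag w B C 0 B.length zt z') :
    (Finset.Icc lo hi).inf (fun zt => btedFrag k w F G lF a lG zt + M zt) ≤
      btedFrag k w F G lF (a + B.length) lG (b + z') := by
  apply le_iInf
  rintro ⟨p, hp, hc, hwd⟩
  obtain ⟨s, v, r, rfl, hv⟩ := align_hits p hp hl (Nat.le_add_right _ _)
  have hwv := hwd v (by simp)
  have hp' := hp
  rw [align_append] at hp
  obtain ⟨h1, h2⟩ := hp
  obtain ⟨q, hq⟩ := unshift a b (v :: r) (by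
    intro u hu
    have := (align_bounds _ h2).2.2.1 u hu
    omega)
  obtain ⟨zt, hzt⟩ := Nat.exists_eq_add_of_le (show b ≤ v.2 by omega)
  have h2' : IsAlignment 0 B.length zt z' q := by
    rw [← align_sh a b, ← hq]
    simpa [hv, hzt] using h2
  have hcc := (consistent_glue hB hC hF hG hq hv h1 h2' hz').1 hc
  have hzz := (align_bounds _ h2').2.1
  refine (Finset.inf_le (b := v.2) (Finset.mem_Icc.2 ⟨by omega, by omega⟩)).trans ?_
  rw [cost_append, hq, cost_sh w hF hG le_rfl hz' q h2', ENNReal.coe_add]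
  apply add_le_add
  · refine iInf_le_of_le ⟨s ++ [v], by rwa [hv] at h1, hcc.1, ?_⟩ le_rfl
    intro u hu
    apply hwd
    simp at hu ⊢
    tauto
  · rw [hzt, hM zt (by omega) hzz]
    exact iInf_le_of_le ⟨q, h2', hcc.2⟩ le_rfl

/-- Third inequality, abstractly. -/
lemma glue_bound {α : Type*} (w : Option α → Option α → ℝ≥0)
    {F G B C : List (Paren α)} {a b : ℕ}
    (hB : IsForest B) (hC : IsForest C) (hF : Occ F a B) (hG : Occ G b C)
    {lF lG zt z' : ℕ} (hz' : z' ≤ C.length) :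
    tedFrag w F G lF (a + B.length) lG (b + z') ≤
      tedFrag w F G lF a lG (b + zt) + tedFrag w B C 0 B.length zt z' := by
  unfold tedFrag
  rw [ENNReal.iInf_add]
  apply le_iInf
  rintro ⟨p, hp, hpc⟩
  rw [ENNReal.add_iInf]
  apply le_iInf
  rintro ⟨q, hq, hqc⟩
  obtain ⟨s, rfl⟩ : ∃ s, p = s ++ [(a, b + zt)] := by
    have := hp.2.1
    rw [List.getLast?_eq_some_iff] at this
    exact this
  obtain ⟨r, hr⟩ : ∃ r, (a, b + zt) :: r = q.map (sh a b) := by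
    cases q with
    | nil => exact absurd hq (align_nil _ _ _ _)
    | cons c q =>
      have : c = (0, zt) := by simpa using hq.1
      exact ⟨q.map (sh a b), by simp [this, sh]⟩
  have h2 : IsAlignment (a + 0) (a + B.length) (b + zt) (b + z') ((a, b + zt) :: r) := by
    rw [hr, align_sh]; exact hq
  refine iInf_le_of_le ⟨s ++ (a, b + zt) :: r, ?_, ?_⟩ ?_
  · rw [align_append]
    exact ⟨hp, h2⟩
  · exact (consistent_glue hB hC hF hG hr rfl hp hq hz').2 ⟨hpc, hqc⟩
  · rw [cost_append, hr, cost_sh w hF hG le_rfl hz' q hq, ENNReal.coe_add]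

end TedStep

open TedStep in
/-- Claim B.1: in the free-pair setting, with
`x_t = p_F + |R|·t` and `y_t = p_G + |R|·t`, for every `t < e` and every
`z ∈ [y_{t+1} − |R|..y_{t+1} + |R|]`, the chain of inequalities relating
`bted_k^w`, `ted^w`, and the matrix `M_R` holds. -/
theorem ted_matrix_single_step {α : Type*}
    (w : Option α → Option α → ℝ≥0) (hw : Normalized w)
    (k : ℕ) (hk : 0 < k)
    (F G : List (Paren α)) (hF : IsForest F) (hG : IsForest G)
    (lF rF lG rG pF qF pG qG : ℕ) (R : List (Paren α)) (e : ℕ)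
    (hrFG : rF ≤ rG + 2 * k) (hrGF : rG ≤ rF + 2 * k)
    (hsuf1 : lF ≤ pF) (hsuf2 : qF = rF)
    (hpFG : pF ≤ pG + 2 * k) (hpGF : pG ≤ pF + 2 * k)
    (hR : IsForest R) (hRlen : 4 * k ≤ R.length) (hRlen' : R.length < 8 * k)
    (he : 0 < e)
    (hpFR : R.length ≤ pF) (hpGR : R.length ≤ pG)
    (hqF : qF + R.length ≤ F.length) (hqG : qG + R.length ≤ G.length)
    (hoccF : frag F (pF - R.length) (qF + R.length) = listPow R (e + 2))
    (hoccG : frag G (pG - R.length) (qG + R.length) = listPow R (e + 2))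
    (t : ℕ) (ht : t < e) (z : ℕ)
    (hz1 : pG + R.length * (t + 1) - R.length ≤ z)
    (hz2 : z ≤ pG + R.length * (t + 1) + R.length) :
    btedFrag k w F G lF (pF + R.length * (t + 1)) lG z ≥
      (Finset.Icc (pG + R.length * t - R.length) (pG + R.length * t + R.length)).inf
        (fun zt => btedFrag k w F G lF (pF + R.length * t) lG zt +
          MR w R ((zt : ℤ) - (pG + R.length * t : ℤ))
            ((z : ℤ) - (pG + R.length * (t + 1) : ℤ))) ∧
    (Finset.Icc (pG + R.length * t - R.length) (pG + R.length * t + R.length)).inf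
        (fun zt => btedFrag k w F G lF (pF + R.length * t) lG zt +
          MR w R ((zt : ℤ) - (pG + R.length * t : ℤ))
            ((z : ℤ) - (pG + R.length * (t + 1) : ℤ))) ≥
      (Finset.Icc (pG + R.length * t - R.length) (pG + R.length * t + R.length)).inf
        (fun zt => tedFrag w F G lF (pF + R.length * t) lG zt +
          MR w R ((zt : ℤ) - (pG + R.length * t : ℤ))
            ((z : ℤ) - (pG + R.length * (t + 1) : ℤ))) ∧
    (Finset.Icc (pG + R.length * t - R.length) (pG + R.length * t + R.length)).inf
        (fun zt => tedFrag w F G lF (pF + R.length * t) lG zt +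
          MR w R ((zt : ℤ) - (pG + R.length * t : ℤ))
            ((z : ℤ) - (pG + R.length * (t + 1) : ℤ))) ≥
      tedFrag w F G lF (pF + R.length * (t + 1)) lG z := by
  have hR0 : 0 < R.length := by omega
  have hFo := occ_pow hoccF (m := t + 1) (n := 1) (by omega)
  have hGo := occ_pow hoccG (m := t) (n := 3) (by omega)
  have e1 : listPow R 1 = R := by simp [listPow]
  rw [e1] at hFo
  have m1 : (t + 1) * R.length = R.length * t + R.length := by ring
  have m2 : t * R.length = R.length * t := by ring
  have m3 : R.length * (t + 1) = R.length * t + R.length := by ring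
  have m4 : (R.length : ℤ) * ((t : ℤ) + 1) = R.length * t + R.length := by ring
  have hCl : (listPow R 3).length = 3 * R.length := listPow_length R 3
  have hC := listPow_forest hR 3
  rw [m3] at hz1 hz2 ⊢
  rw [m4]
  rw [m1] at hFo
  rw [m2] at hGo
  obtain ⟨a, ha⟩ : ∃ a, a = pF + R.length * t := ⟨_, rfl⟩
  obtain ⟨b, hb⟩ : ∃ b, b = pG - R.length + R.length * t := ⟨_, rfl⟩
  have ea : pF - R.length + (R.length * t + R.length) = a := by omega
  rw [ea] at hFo
  rw [← hb] at hGo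
  have ey : pG + R.length * t = b + R.length := by omega
  have eyz : (pG : ℤ) + (R.length : ℤ) * t = b + R.length := by exact_mod_cast ey
  rw [← ha, ey, ← add_assoc, ← ha, ← add_assoc, eyz]
  obtain ⟨z', rfl⟩ := Nat.exists_eq_add_of_le (show b ≤ z by omega)
  have hz' : z' ≤ (listPow R 3).length := by omega
  have hM : ∀ zt, zt ≤ z' →
      MR w R (((b + zt : ℕ) : ℤ) - (b + R.length : ℤ))
        (((b + z' : ℕ) : ℤ) - (b + R.length + R.length : ℤ)) =
      tedFrag w R (listPow R 3) 0 R.length zt z' := by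
    intro zt hzt
    unfold MR
    rw [if_pos (by push_cast; omega)]
    congr 1 <;> (push_cast; omega)
  refine ⟨?_, ?_, ?_⟩
  · refine split_bound w k hR hC hFo hGo (M := fun zt => MR w R ((zt : ℤ) - (b + R.length : ℤ))
      (((b + z' : ℕ) : ℤ) - (b + R.length + R.length : ℤ))) (by omega) hz' (by omega) (by omega)
      (by omega) ?_
    intro zt _ hzt
    exact hM zt hzt
  · apply Finset.inf_mono_fun
    intro zt _
    gcongr
    apply le_iInf
    rintro ⟨p, hp, hc, _⟩
    exact iInf_le_of_le ⟨p, hp, hc⟩ le_rfl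
  · apply Finset.le_inf
    intro zt hzt
    rw [Finset.mem_Icc] at hzt
    obtain ⟨zt, rfl⟩ := Nat.exists_eq_add_of_le (show b ≤ zt by omega)
    by_cases h : zt ≤ z'
    · rw [hM zt h]
      exact glue_bound w hR hC hFo hGo hz'
    · unfold MR
      rw [if_neg (by push_cast; omega)]
      simp
end

section
/- Let k ∈ ℤ+ and let P, P' be forests each containing at least 158k² red characters. Then P and P' are ted^w_{≤k}-equivalent for every normalized quasimetric weight function w. -/
open scoped NNReal ENNReal

attribute [local instance] Classical.propDecidable

/-- A string `S` over `P_Σ` is a periodic block (Definition 5.4): `|S| ≥ 42k` and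
`S` has a string period of length at most `4k` containing equally many opening
and closing parentheses. -/
def IsPeriodicBlock {α : Type*} (k : ℕ) (S : List (Paren α)) : Prop :=
  42 * k ≤ S.length ∧ ∃ p, 0 < p ∧ p ≤ 4 * k ∧
    (∀ i, i + p < S.length → S[i]? = S[i + p]?) ∧
    (S.take p).countP (fun c => c.1) = (S.take p).countP (fun c => !c.1)

/-- A character `T[i]` is black (Definition 5.5) if there exists a periodic block
`T[l..r)` of `T` such that `i ∈ [l + 5k..r − 5k)`; otherwise it is red. -/
def IsBlack {α : Type*} (k : ℕ) (T : List (Paren α)) (i : ℕ) : Prop :=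
  ∃ l r, r ≤ T.length ∧ l + 5 * k ≤ i ∧ i + 5 * k < r ∧ IsPeriodicBlock k (frag T l r)

/-- The number of red characters of `T`. -/
noncomputable def redCount {α : Type*} (k : ℕ) (T : List (Paren α)) : ℕ :=
  ((Finset.range T.length).filter fun i => ¬ IsBlack k T i).card

/-- The capped tree edit distance `ted^w_{≤k}(F, G)`: equal to `ted^w(F, G)` if the
latter is at most `k`, and `∞` otherwise. -/
noncomputable def tedLE {α : Type*} (k : ℕ) (w : Option α → Option α → ℝ≥0)
    (F G : List (Paren α)) : ℝ≥0∞ :=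
  if tedFrag w F G 0 F.length 0 G.length ≤ (k : ℝ≥0∞) then
    tedFrag w F G 0 F.length 0 G.length
  else ⊤

/-- Forests `P` and `P'` are `ted^w_{≤k}`-equivalent (Definition 5.8): for all forests
`F = F₁ · P · F₂` and `G = G₁ · P · G₂` with matching occurrences of `P` at positions
`l_F = |F₁|` and `l_G = |G₁|` satisfying `|l_F − l_G| ≤ 2k`, replacing both
occurrences of `P` by `P'` preserves `ted^w_{≤k}`. -/
def ForestEquiv {α : Type*} (k : ℕ) (w : Option α → Option α → ℝ≥0)
    (P P' : List (Paren α)) : Prop :=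
  ∀ F1 F2 G1 G2 : List (Paren α),
    IsForest (F1 ++ P ++ F2) → IsForest (G1 ++ P ++ G2) →
    F1.length ≤ G1.length + 2 * k → G1.length ≤ F1.length + 2 * k →
    tedLE k w (F1 ++ P ++ F2) (G1 ++ P ++ G2) = tedLE k w (F1 ++ P' ++ F2) (G1 ++ P' ++ G2)

/-! ### Alignments as an inductive predicate -/

inductive Al {α : Type*} (w : Option α → Option α → ℝ≥0) (X Y : List (Paren α)) :
    ℕ → ℕ → ℕ → ℕ → List (ℕ × ℕ) → List ℕ → ℝ≥0 → Prop
  | nil (x y : ℕ) : Al w X Y x y x y [] [] 0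
  | del {x y x' y' : ℕ} {S : List (ℕ × ℕ)} {E : List ℕ} {c : ℝ≥0} :
      Al w X Y (x + 1) y x' y' S E c →
      Al w X Y x y x' y' S (x :: E) ((1 / 2 : ℝ≥0) * w (lbl X x) none + c)
  | ins {x y x' y' : ℕ} {S : List (ℕ × ℕ)} {E : List ℕ} {c : ℝ≥0} :
      Al w X Y x (y + 1) x' y' S E c →
      Al w X Y x y x' y' S (x :: E) ((1 / 2 : ℝ≥0) * w none (lbl Y y) + c)
  | diag {x y x' y' : ℕ} {S : List (ℕ × ℕ)} {E : List ℕ} {c : ℝ≥0} :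
      Al w X Y (x + 1) (y + 1) x' y' S E c →
      Al w X Y x y x' y' ((x, y) :: S) (if lbl X x = lbl Y y then E else x :: E)
        ((1 / 2 : ℝ≥0) * w (lbl X x) (lbl Y y) + c)

theorem alignsAt_cons {p q : ℕ × ℕ} {rest : List (ℕ × ℕ)} {f g : ℕ} :
    AlignsAt (p :: q :: rest) f g ↔
      (p = (f, g) ∧ q = (f + 1, g + 1)) ∨ AlignsAt (q :: rest) f g := by
  constructor
  · rintro ⟨t, h1, h2⟩
    cases t with
    | zero =>
      left
      simp only [List.getElem?_cons_zero, Option.some.injEq, zero_add, List.getElem?_cons_succ] at h1 h2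
      exact ⟨h1, h2⟩
    | succ t => right; exact ⟨t, by simpa using h1, by simpa using h2⟩
  · rintro (⟨h1, h2⟩ | ⟨t, h1, h2⟩)
    · exact ⟨0, by simp [h1], by simp [h2]⟩
    · exact ⟨t + 1, by simpa using h1, by simpa using h2⟩

theorem alignsAt_single {p : ℕ × ℕ} {f g : ℕ} : ¬ AlignsAt [p] f g := by
  rintro ⟨t, h1, h2⟩
  simp at h2

theorem Al.of_list {α : Type*} (w : Option α → Option α → ℝ≥0) (X Y : List (Paren α))
    (path : List (ℕ × ℕ)) : ∀ x y x' y' : ℕ, IsAlignment x x' y y' path →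
    ∃ S E, Al w X Y x y x' y' S E (pathCost w X Y path) ∧
      ∀ f g, (f, g) ∈ S ↔ AlignsAt path f g := by
  induction path with
  | nil => intro x y x' y' h; simp [IsAlignment] at h
  | cons p l ih =>
    intro x y x' y' h
    obtain ⟨h1, h2, h3⟩ := h
    simp only [List.head?_cons, Option.some.injEq] at h1
    subst h1
    cases l with
    | nil =>
      simp only [List.getLast?_singleton, Option.some.injEq, Prod.mk.injEq] at h2
      obtain ⟨rfl, rfl⟩ := h2
      refine ⟨[], [], by simpa [pathCost] using Al.nil x y, fun f g => ?_⟩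
      simp [alignsAt_single]
    | cons q rest =>
      have hthird' := List.isChain_cons_cons.1 h3
      obtain ⟨hs, hc⟩ := hthird'
      have h2' : (q :: rest).getLast? = some (x', y') := by
        simpa [List.getLast?_cons_cons] using h2
      obtain ⟨S, E, hA, hS⟩ := ih q.1 q.2 x' y' ⟨by simp, h2', hc⟩
      rcases hs with rfl | rfl | rfl
      · refine ⟨S, _, by simpa [pathCost] using Al.del hA, fun f g => ?_⟩
        rw [alignsAt_cons, hS]
        simp; omega
      · refine ⟨S, _, by simpa [pathCost] using Al.ins hA, fun f g => ?_⟩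
        rw [alignsAt_cons, hS]
        simp; omega
      · refine ⟨_, _, by simpa [pathCost] using Al.diag hA, fun f g => ?_⟩
        rw [alignsAt_cons, ← hS]
        simp
        grind

theorem Al.to_list {α : Type*} {w : Option α → Option α → ℝ≥0} {X Y : List (Paren α)}
    {x y x' y' : ℕ} {S : List (ℕ × ℕ)} {E : List ℕ} {c : ℝ≥0} (h : Al w X Y x y x' y' S E c) :
    ∃ path, IsAlignment x x' y y' path ∧ pathCost w X Y path = c ∧
      ∀ f g, (f, g) ∈ S ↔ AlignsAt path f g := by
  induction h with
  | nil x y =>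
    exact ⟨[(x, y)], ⟨by simp, by simp, List.isChain_singleton _⟩, by simp [pathCost], by simp [alignsAt_single]⟩
  | @del x y x' y' S E c h ih =>
    obtain ⟨path, ⟨h1, h2, h3⟩, hc, hS⟩ := ih
    cases path with
    | nil => simp at h1
    | cons q rest =>
      simp only [List.head?_cons, Option.some.injEq] at h1
      subst h1
      refine ⟨(x, y) :: _ :: rest, ⟨by simp, by simpa [List.getLast?_cons_cons] using h2,
        List.isChain_cons_cons.2 ⟨by simp [AlignStep], h3⟩⟩, ?_, fun f g => ?_⟩
      · simp [pathCost, hc]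
      · rw [alignsAt_cons, hS]; simp; omega
  | @ins x y x' y' S E c h ih =>
    obtain ⟨path, ⟨h1, h2, h3⟩, hc, hS⟩ := ih
    cases path with
    | nil => simp at h1
    | cons q rest =>
      simp only [List.head?_cons, Option.some.injEq] at h1
      subst h1
      refine ⟨(x, y) :: _ :: rest, ⟨by simp, by simpa [List.getLast?_cons_cons] using h2,
        List.isChain_cons_cons.2 ⟨by simp [AlignStep], h3⟩⟩, ?_, fun f g => ?_⟩
      · simp [pathCost, hc]
      · rw [alignsAt_cons, hS]; simp; omega
  | @diag x y x' y' S E c h ih =>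
    obtain ⟨path, ⟨h1, h2, h3⟩, hc, hS⟩ := ih
    cases path with
    | nil => simp at h1
    | cons q rest =>
      simp only [List.head?_cons, Option.some.injEq] at h1
      subst h1
      refine ⟨(x, y) :: _ :: rest, ⟨by simp, by simpa [List.getLast?_cons_cons] using h2,
        List.isChain_cons_cons.2 ⟨by simp [AlignStep], h3⟩⟩, ?_, fun f g => ?_⟩
      · simp [pathCost, hc]
      · rw [alignsAt_cons, ← hS]; simp; grind

section AlBasics

variable {α : Type*} {w : Option α → Option α → ℝ≥0} {X Y : List (Paren α)}
  {x y x' y' : ℕ} {S : List (ℕ × ℕ)} {E : List ℕ} {c : ℝ≥0}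

theorem Al.le (h : Al w X Y x y x' y' S E c) : x ≤ x' ∧ y ≤ y' := by
  induction h <;> omega

theorem Al.mem_bd (h : Al w X Y x y x' y' S E c) : ∀ f g, (f, g) ∈ S →
    x ≤ f ∧ f < x' ∧ y ≤ g ∧ g < y' := by
  induction h with
  | nil => simp
  | del h ih => intro f g hm; have := ih f g hm; omega
  | ins h ih => intro f g hm; have := ih f g hm; omega
  | diag h ih =>
    intro f g hm
    have := h.le
    rcases List.mem_cons.1 hm with h1 | h1
    · simp only [Prod.mk.injEq] at h1; omega
    · have := ih f g h1; omega

theorem Al.mono (h : Al w X Y x y x' y' S E c) : ∀ f g f' g', (f, g) ∈ S → (f', g') ∈ S →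
    f < f' → g < g' := by
  induction h with
  | nil => simp
  | del h ih => exact ih
  | ins h ih => exact ih
  | diag h ih =>
    intro f g f' g' h1 h2 hlt
    have hb := h.mem_bd
    rcases List.mem_cons.1 h1 with h1 | h1 <;> rcases List.mem_cons.1 h2 with h2 | h2
    · simp only [Prod.mk.injEq] at h1 h2; omega
    · simp only [Prod.mk.injEq] at h1; have := hb _ _ h2; omega
    · simp only [Prod.mk.injEq] at h2; have := hb _ _ h1; omega
    · exact ih _ _ _ _ h1 h2 hlt

theorem Al.lbl_eq (h : Al w X Y x y x' y' S E c) : ∀ f g, (f, g) ∈ S →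
    f ∉ E → lbl X f = lbl Y g := by
  induction h with
  | nil => simp
  | del h ih => intro f g hm he; exact ih f g hm (fun h' => he (List.mem_cons_of_mem _ h'))
  | ins h ih => intro f g hm he; exact ih f g hm (fun h' => he (List.mem_cons_of_mem _ h'))
  | diag h ih =>
    intro f g hm he
    rcases List.mem_cons.1 hm with h1 | h1
    · simp only [Prod.mk.injEq] at h1
      obtain ⟨rfl, rfl⟩ := h1
      by_contra hne
      simp [hne] at he
    · refine ih f g h1 (fun h' => he ?_)
      split_ifs
      · exact h'
      · exact List.mem_cons_of_mem _ h'

theorem Al.off (h : Al w X Y x y x' y' S E c) :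
    x' + y ≤ y' + x + E.length ∧ y' + x ≤ x' + y + E.length := by
  induction h with
  | nil => simp; omega
  | del h ih => simp; omega
  | ins h ih => simp; omega
  | diag h ih => 
    split_ifs
    · omega
    · simp only [List.length_cons]; omega

theorem Al.edits (hw : Normalized w) (h : Al w X Y x y x' y' S E c) :
    x' ≤ X.length → y' ≤ Y.length → (E.length : ℝ≥0) ≤ 2 * c := by
  have key : ∀ a b : Option α, a ≠ b → (1 : ℝ≥0) ≤ 2 * (1 / 2 * w a b) := by
    intro a b hab
    rw [← mul_assoc]
    simpa using hw.2 a b hab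
  induction h with
  | nil => simp
  | @del x y x' y' S E c h ih =>
    intro h1 h2
    have := h.le
    have hx : lbl X x ≠ none := by
      simp [lbl]; omega
    have := key _ _ hx
    have := ih h1 h2
    rw [mul_add]
    push_cast [List.length_cons]
    rw [add_comm]
    gcongr
  | @ins x y x' y' S E c h ih =>
    intro h1 h2
    have := h.le
    have hx : none ≠ lbl Y y := by
      intro hh
      have := hh.symm
      simp [lbl] at this; omega
    have := key _ _ hx
    have := ih h1 h2
    rw [mul_add]
    push_cast [List.length_cons]
    rw [add_comm]
    gcongr
  | @diag x y x' y' S E c h ih =>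
    intro h1 h2
    have h3 := ih h1 h2
    rw [mul_add]
    split_ifs with hh
    · exact h3.trans le_add_self
    · have := key _ _ hh
      push_cast [List.length_cons]
      rw [add_comm]
      gcongr

theorem Al.append {u v : ℕ} (h : Al w X Y x y u v S E c) :
    ∀ {S' : List (ℕ × ℕ)} {E' : List ℕ} {c' : ℝ≥0}, Al w X Y u v x' y' S' E' c' →
    Al w X Y x y x' y' (S ++ S') (E ++ E') (c + c') := by
  induction h with
  | nil => intro S' E' c' h'; simpa using h'
  | del h ih => intro S' E' c' h'; simpa [add_assoc] using Al.del (ih h')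
  | ins h ih => intro S' E' c' h'; simpa [add_assoc] using Al.ins (ih h')
  | diag h ih =>
    intro S' E' c' h'
    have := Al.diag (ih h')
    rw [add_assoc]
    have he : ∀ (p : Prop) [Decidable p] (a : ℕ) (A B : List ℕ), (if p then A else a :: A) ++ B =
        if p then A ++ B else a :: (A ++ B) := by
      intro p _ a A B
      split_ifs <;> simp
    rw [he]
    exact this

theorem Al.split (Q : ℕ → ℕ → Prop) (h : Al w X Y x y x' y' S E c) : Q x' y' →
    ∃ u v S1 S2 E1 E2 c1 c2, Al w X Y x y u v S1 E1 c1 ∧ Al w X Y u v x' y' S2 E2 c2 ∧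
      S = S1 ++ S2 ∧ E = E1 ++ E2 ∧ c = c1 + c2 ∧ Q u v ∧
      ((u = x ∧ v = y) ∨ ∃ a b, ¬ Q a b ∧ x ≤ a ∧ y ≤ b ∧ AlignStep (a, b) (u, v)) := by
  induction h with
  | nil x y =>
    intro hQ
    exact ⟨x, y, [], [], [], [], 0, 0, .nil _ _, .nil _ _, by simp, by simp, by simp, hQ, by simp⟩
  | @del x y x' y' S E c h ih =>
    intro hQ
    by_cases hq : Q x y
    · exact ⟨x, y, [], _, [], _, 0, _, .nil _ _, .del h, by simp, by simp, by simp, hq, by simp⟩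
    · obtain ⟨u, v, S1, S2, E1, E2, c1, c2, h1, h2, hS, hE, hc, hq', hh⟩ := ih hQ
      refine ⟨u, v, _, S2, _, E2, _, c2, .del h1, h2, by simp [hS], by simp [hE],
        by simp [hc, add_assoc], hq', Or.inr ?_⟩
      rcases hh with ⟨rfl, rfl⟩ | ⟨a, b, h3, h4, h5, h6⟩
      · exact ⟨x, v, hq, le_rfl, le_rfl, by simp [AlignStep]⟩
      · exact ⟨a, b, h3, by omega, by omega, h6⟩
  | @ins x y x' y' S E c h ih =>
    intro hQ
    by_cases hq : Q x y
    · exact ⟨x, y, [], _, [], _, 0, _, .nil _ _, .ins h, by simp, by simp, by simp, hq, by simp⟩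
    · obtain ⟨u, v, S1, S2, E1, E2, c1, c2, h1, h2, hS, hE, hc, hq', hh⟩ := ih hQ
      refine ⟨u, v, _, S2, _, E2, _, c2, .ins h1, h2, by simp [hS], by simp [hE],
        by simp [hc, add_assoc], hq', Or.inr ?_⟩
      rcases hh with ⟨rfl, rfl⟩ | ⟨a, b, h3, h4, h5, h6⟩
      · exact ⟨u, y, hq, le_rfl, le_rfl, by simp [AlignStep]⟩
      · exact ⟨a, b, h3, by omega, by omega, h6⟩
  | @diag x y x' y' S E c h ih =>
    intro hQ
    by_cases hq : Q x y
    · exact ⟨x, y, [], _, [], _, 0, _, .nil _ _, .diag h, by simp, by simp, by simp, hq, by simp⟩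
    · obtain ⟨u, v, S1, S2, E1, E2, c1, c2, h1, h2, hS, hE, hc, hq', hh⟩ := ih hQ
      refine ⟨u, v, _, S2, _, E2, _, c2, .diag h1, h2, by simp [hS], by split_ifs <;> simp [hE],
        by simp [hc, add_assoc], hq', Or.inr ?_⟩
      rcases hh with ⟨rfl, rfl⟩ | ⟨a, b, h3, h4, h5, h6⟩
      · exact ⟨x, y, hq, le_rfl, le_rfl, by simp [AlignStep]⟩
      · exact ⟨a, b, h3, by omega, by omega, h6⟩

/-- Splitting at an aligned pair. -/
theorem Al.split_mem (h : Al w X Y x y x' y' S E c) : ∀ f g, (f, g) ∈ S →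
    ∃ S1 S2 E1 E2 c1 c2, Al w X Y x y f g S1 E1 c1 ∧ Al w X Y f g x' y' S2 E2 c2 ∧
      S = S1 ++ S2 ∧ E = E1 ++ E2 ∧ c = c1 + c2 := by
  induction h with
  | nil x y => simp
  | del h ih =>
    intro f g hm
    obtain ⟨S1, S2, E1, E2, c1, c2, h1, h2, rfl, rfl, rfl⟩ := ih f g hm
    exact ⟨_, _, _, _, _, _, .del h1, h2, by simp, by simp, by simp [add_assoc]⟩
  | ins h ih =>
    intro f g hm
    obtain ⟨S1, S2, E1, E2, c1, c2, h1, h2, rfl, rfl, rfl⟩ := ih f g hm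
    exact ⟨_, _, _, _, _, _, .ins h1, h2, by simp, by simp, by simp [add_assoc]⟩
  | diag h ih =>
    intro f g hm
    rcases List.mem_cons.1 hm with h1 | h1
    · simp only [Prod.mk.injEq] at h1
      obtain ⟨rfl, rfl⟩ := h1
      exact ⟨_, _, _, _, _, _, .nil _ _, .diag h, by simp, by simp, by simp⟩
    · obtain ⟨S1, S2, E1, E2, c1, c2, h3, h2, rfl, rfl, rfl⟩ := ih f g h1
      exact ⟨_, _, _, _, _, _, .diag h3, h2, by simp, by split_ifs <;> simp, by simp [add_assoc]⟩

theorem Al.first (h : Al w X Y x y x' y' S E c) (hx : x < x') (he : x ∉ E) : (x, y) ∈ S := by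
  cases h with
  | nil => omega
  | del h => simp at he
  | ins h => simp at he
  | diag h => simp

theorem Al.exists_mem (h : Al w X Y x y x' y' S E c) : ∀ z, x ≤ z → z < x' → z ∉ E →
    ∃ g, (z, g) ∈ S := by
  induction h with
  | nil => intros; omega
  | @del x y _ _ _ _ _ h ih =>
    intro z h1 h2 h3
    rw [List.mem_cons, not_or] at h3
    exact ih z (by omega) h2 h3.2
  | ins h ih =>
    intro z h1 h2 h3
    rw [List.mem_cons, not_or] at h3
    exact ih z h1 h2 h3.2
  | @diag x y _ _ _ _ _ h ih =>
    intro z h1 h2 h3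
    by_cases hz : z = x
    · exact ⟨y, by simp [hz]⟩
    · obtain ⟨g, hg⟩ := ih z (by omega) h2 (fun h' => h3 (by
        split_ifs
        · exact h'
        · exact List.mem_cons_of_mem _ h'))
      exact ⟨g, by simp [hg]⟩

theorem Al.next (h : Al w X Y x y x' y' S E c) : ∀ z g, (z, g) ∈ S → z + 1 < x' → z + 1 ∉ E →
    (z + 1, g + 1) ∈ S := by
  induction h with
  | nil => simp
  | @del x y _ _ _ _ _ h ih =>
    intro z g h1 h2 h3
    rw [List.mem_cons, not_or] at h3
    exact ih z g h1 h2 h3.2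
  | ins h ih =>
    intro z g h1 h2 h3
    rw [List.mem_cons, not_or] at h3
    exact ih z g h1 h2 h3.2
  | @diag x y _ _ _ _ _ h ih =>
    intro z g h1 h2 h3
    have hthird' := (fun h' => h3 (by
        split_ifs
        · exact h'
        · exact List.mem_cons_of_mem _ h'))
    rcases List.mem_cons.1 h1 with h1 | h1
    · simp only [Prod.mk.injEq] at h1
      obtain ⟨rfl, rfl⟩ := h1
      exact List.mem_cons_of_mem _ (h.first h2 hthird')
    · exact List.mem_cons_of_mem _ (ih z g h1 h2 hthird')

/-- Discrete intermediate value: an alignment whose offset changes sign visits offset zero. -/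
theorem Al.cross_up {a b : ℕ} (h : Al w X Y x y x' y' S E c) (h1 : x + b ≤ y + a)
    (h2 : y' + a ≤ x' + b) :
    ∃ u v S1 S2 E1 E2 c1 c2, Al w X Y x y u v S1 E1 c1 ∧ Al w X Y u v x' y' S2 E2 c2 ∧
      S = S1 ++ S2 ∧ E = E1 ++ E2 ∧ c = c1 + c2 ∧ u + b = v + a := by
  obtain ⟨u, v, S1, S2, E1, E2, c1, c2, hA, hB, hS, hE, hc, hq, hh⟩ :=
    h.split (fun u v => v + a ≤ u + b) h2
  refine ⟨u, v, S1, S2, E1, E2, c1, c2, hA, hB, hS, hE, hc, ?_⟩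
  rcases hh with ⟨rfl, rfl⟩ | ⟨p, q, h3, _, _, h6⟩
  · omega
  · simp only [AlignStep, Prod.mk.injEq] at h6
    omega

theorem Al.cross_dn {a b : ℕ} (h : Al w X Y x y x' y' S E c) (h1 : y + a ≤ x + b)
    (h2 : x' + b ≤ y' + a) :
    ∃ u v S1 S2 E1 E2 c1 c2, Al w X Y x y u v S1 E1 c1 ∧ Al w X Y u v x' y' S2 E2 c2 ∧
      S = S1 ++ S2 ∧ E = E1 ++ E2 ∧ c = c1 + c2 ∧ u + b = v + a := by
  obtain ⟨u, v, S1, S2, E1, E2, c1, c2, hA, hB, hS, hE, hc, hq, hh⟩ :=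
    h.split (fun u v => u + b ≤ v + a) h2
  refine ⟨u, v, S1, S2, E1, E2, c1, c2, hA, hB, hS, hE, hc, ?_⟩
  rcases hh with ⟨rfl, rfl⟩ | ⟨p, q, h3, _, _, h6⟩
  · omega
  · simp only [AlignStep, Prod.mk.injEq] at h6
    omega

/-- Deletion potential. -/
theorem Al.pot_del (hq : Quasimetric w) (h : Al w X Y x y x' y' S E c) :
    ∑ z ∈ Finset.Ico x x', (1 / 2 : ℝ≥0) * w (lbl X z) none ≤
      c + ∑ z ∈ Finset.Ico y y', (1 / 2 : ℝ≥0) * w (lbl Y z) none := by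
  induction h with
  | nil => simp
  | del h ih =>
    have := h.le
    rw [Finset.sum_eq_sum_Ico_succ_bot (by omega), add_assoc]
    gcongr
  | @ins x y x' y' S E c h ih =>
    have := h.le
    rw [Finset.sum_eq_sum_Ico_succ_bot (show y < y' by omega)]
    refine ih.trans ?_
    rw [← add_assoc]
    gcongr
    · exact le_add_right le_add_self
  | @diag x y x' y' S E c h ih =>
    have := h.le
    rw [Finset.sum_eq_sum_Ico_succ_bot (show x < x' by omega),
      Finset.sum_eq_sum_Ico_succ_bot (show y < y' by omega), add_assoc, add_left_comm c, ← add_assoc,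
      ← mul_add]
    gcongr
    exact hq _ _ _

/-- Insertion potential. -/
theorem Al.pot_ins (hq : Quasimetric w) (h : Al w X Y x y x' y' S E c) :
    ∑ z ∈ Finset.Ico y y', (1 / 2 : ℝ≥0) * w none (lbl Y z) ≤
      c + ∑ z ∈ Finset.Ico x x', (1 / 2 : ℝ≥0) * w none (lbl X z) := by
  induction h with
  | nil => simp
  | ins h ih =>
    have := h.le
    rw [Finset.sum_eq_sum_Ico_succ_bot (by omega), add_assoc]
    gcongr
  | @del x y x' y' S E c h ih =>
    have := h.le
    rw [Finset.sum_eq_sum_Ico_succ_bot (show x < x' by omega)]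
    refine ih.trans ?_
    rw [← add_assoc]
    gcongr
    · exact le_add_right le_add_self
  | @diag x y x' y' S E c h ih =>
    have := h.le
    rw [Finset.sum_eq_sum_Ico_succ_bot (show x < x' by omega),
      Finset.sum_eq_sum_Ico_succ_bot (show y < y' by omega), add_assoc, add_left_comm c, ← add_assoc,
      ← mul_add]
    gcongr
    rw [add_comm]
    exact hq _ _ _

theorem Al.delAll (w : Option α → Option α → ℝ≥0) (X Y : List (Paren α)) (y n : ℕ) : ∀ x : ℕ,
    ∃ E, Al w X Y x y (x + n) y [] E
      (∑ z ∈ Finset.Ico x (x + n), (1 / 2 : ℝ≥0) * w (lbl X z) none) := by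
  induction n with
  | zero => intro x; exact ⟨[], by simpa using Al.nil x y⟩
  | succ n ih =>
    intro x
    obtain ⟨E, h⟩ := ih (x + 1)
    rw [show x + 1 + n = x + (n + 1) by omega] at h
    rw [Finset.sum_eq_sum_Ico_succ_bot (show x < x + (n + 1) by omega)]
    exact ⟨_, .del h⟩

theorem Al.insAll (w : Option α → Option α → ℝ≥0) (X Y : List (Paren α)) (x n : ℕ) : ∀ y : ℕ,
    ∃ E, Al w X Y x y x (y + n) [] E
      (∑ z ∈ Finset.Ico y (y + n), (1 / 2 : ℝ≥0) * w none (lbl Y z)) := by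
  induction n with
  | zero => intro y; exact ⟨[], by simpa using Al.nil x y⟩
  | succ n ih =>
    intro y
    obtain ⟨E, h⟩ := ih (y + 1)
    rw [show y + 1 + n = y + (n + 1) by omega] at h
    rw [Finset.sum_eq_sum_Ico_succ_bot (show y < y + (n + 1) by omega)]
    exact ⟨_, .ins h⟩

theorem Al.diagAll (hw : Normalized w) (X Y : List (Paren α)) (n : ℕ) : ∀ x y : ℕ,
    (∀ j < n, lbl X (x + j) = lbl Y (y + j)) →
    ∃ S E, Al w X Y x y (x + n) (y + n) S E 0 ∧
      ∀ f g, (f, g) ∈ S ↔ ∃ j < n, f = x + j ∧ g = y + j := by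
  induction n with
  | zero => intro x y _; exact ⟨[], [], Al.nil x y, by simp⟩
  | succ n ih =>
    intro x y hl
    obtain ⟨S, E, h, hS⟩ := ih (x + 1) (y + 1) (fun j hj => by
      have := hl (j + 1) (by omega)
      rwa [show x + 1 + j = x + (j + 1) by omega, show y + 1 + j = y + (j + 1) by omega])
    rw [show x + 1 + n = x + (n + 1) by omega, show y + 1 + n = y + (n + 1) by omega] at h
    have h0 := hl 0 (by omega)
    simp only [add_zero] at h0
    refine ⟨_, _, by simpa [h0, hw.1] using Al.diag h, fun f g => ?_⟩
    rw [List.mem_cons, hS]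
    constructor
    · rintro (h1 | ⟨j, hj, rfl, rfl⟩)
      · simp only [Prod.mk.injEq] at h1
        exact ⟨0, by omega, by omega, by omega⟩
      · exact ⟨j + 1, by omega, by omega, by omega⟩
    · rintro ⟨j, hj, rfl, rfl⟩
      cases j with
      | zero => left; simp
      | succ j => right; exact ⟨j, by omega, by omega, by omega⟩

/-- Transporting an alignment to a shifted window. -/
theorem Al.shift {X' Y' : List (Paren α)} {r r' s s' : ℕ} (h : Al w X Y x y x' y' S E c) :
    ∀ u v u' v', x = r + u → y = s + v → x' = r + u' → y' = s + v' →
    (∀ j < u', lbl X (r + j) = lbl X' (r' + j)) → (∀ j < v', lbl Y (s + j) = lbl Y' (s' + j)) →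
    ∃ S' E', Al w X' Y' (r' + u) (s' + v) (r' + u') (s' + v') S' E' c ∧
      ∀ f g, (f, g) ∈ S' ↔ ∃ a b, f = r' + a ∧ g = s' + b ∧ (r + a, s + b) ∈ S := by
  induction h with
  | nil x y =>
    intro u v u' v' h1 h2 h3 h4 _ _
    obtain rfl : u = u' := by omega
    obtain rfl : v = v' := by omega
    exact ⟨[], [], .nil _ _, by simp⟩
  | del h ih =>
    intro u v u' v' h1 h2 h3 h4 hX hY
    have := h.le
    obtain ⟨S', E', hA, hS⟩ := ih (u + 1) v u' v' (by omega) h2 h3 h4 hX hY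
    subst h1
    rw [hX u (by omega)]
    exact ⟨S', _, .del hA, hS⟩
  | ins h ih =>
    intro u v u' v' h1 h2 h3 h4 hX hY
    have := h.le
    obtain ⟨S', E', hA, hS⟩ := ih u (v + 1) u' v' h1 (by omega) h3 h4 hX hY
    subst h2
    rw [hY v (by omega)]
    exact ⟨S', _, .ins hA, hS⟩
  | diag h ih =>
    intro u v u' v' h1 h2 h3 h4 hX hY
    have := h.le
    obtain ⟨S', E', hA, hS⟩ := ih (u + 1) (v + 1) u' v' (by omega) (by omega) h3 h4 hX hY
    subst h1 h2
    rw [hX u (by omega), hY v (by omega)]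
    refine ⟨_, _, .diag hA, fun f g => ?_⟩
    rw [List.mem_cons, hS]
    constructor
    · rintro (h1 | ⟨a, b, rfl, rfl, h1⟩)
      · simp only [Prod.mk.injEq] at h1
        exact ⟨u, v, h1.1, h1.2, by simp⟩
      · exact ⟨a, b, rfl, rfl, by simp [h1]⟩
    · rintro ⟨a, b, rfl, rfl, h1⟩
      rcases List.mem_cons.1 h1 with h1 | h1
      · simp only [Prod.mk.injEq] at h1
        left
        simp only [Prod.mk.injEq]; omega
      · exact Or.inr ⟨a, b, rfl, rfl, h1⟩

theorem sum_Ico_shift_eq {X Y : List (Paren α)} (φ : Option α → ℝ≥0) (a b i : ℕ)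
    (hl : ∀ z < i, lbl X (a + z) = lbl Y (b + z)) :
    ∑ z ∈ Finset.Ico a (a + i), φ (lbl X z) = ∑ z ∈ Finset.Ico b (b + i), φ (lbl Y z) := by
  rw [Finset.sum_Ico_eq_sum_range, Finset.sum_Ico_eq_sum_range]
  simp only [Nat.add_sub_cancel_left]
  exact Finset.sum_congr rfl (fun z hz => by rw [hl z (Finset.mem_range.1 hz)])

/-- Cutting the prefix at the beginning of the common fragment. -/
theorem Al.prefix (hq : Quasimetric w) {l m i : ℕ}
    (h : Al w X Y x y (l + i) (m + i) S E c) (hx : x ≤ l) (hy : y ≤ m)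
    (hl : ∀ z < i, lbl X (l + z) = lbl Y (m + z)) :
    ∃ S' E' c', Al w X Y x y l m S' E' c' ∧ c' ≤ c ∧
      ∀ f g, (f, g) ∈ S' ↔ (f, g) ∈ S ∧ f < l ∧ g < m := by
  obtain ⟨u, v, S1, S2, E1, E2, c1, c2, hA, hB, rfl, rfl, rfl, hQ, hh⟩ :=
    h.split (fun u v => l ≤ u ∨ m ≤ v) (by omega)
  have hAl := hA.le
  have hBl := hB.le
  have huv : u ≤ l ∧ v ≤ m := by
    rcases hh with ⟨rfl, rfl⟩ | ⟨a, b, h1, _, _, h2⟩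
    · exact ⟨hx, hy⟩
    · simp only [AlignStep, Prod.mk.injEq] at h2
      omega
  have hS : ∀ f g, (f, g) ∈ S1 ↔ (f, g) ∈ S1 ++ S2 ∧ f < l ∧ g < m := by
    intro f g
    constructor
    · intro h1
      have := hA.mem_bd f g h1
      exact ⟨List.mem_append_left _ h1, by omega, by omega⟩
    · rintro ⟨h1, h2, h3⟩
      rcases List.mem_append.1 h1 with h1 | h1
      · exact h1
      · have := hB.mem_bd f g h1
        omega
  rcases hQ with hQ | hQ
  · obtain rfl : u = l := by omega
    obtain ⟨n, rfl⟩ := Nat.exists_eq_add_of_le huv.2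
    obtain ⟨E', hI⟩ := Al.insAll w X Y u n v
    refine ⟨_, _, _, hA.append hI, ?_, by simpa using hS⟩
    gcongr
    have := hB.pot_ins hq
    rw [sum_Ico_shift_eq (fun o => (1 / 2 : ℝ≥0) * w none o) u (v + n) i hl,
      ← Finset.sum_Ico_consecutive _ (show v ≤ v + n by omega) (show v + n ≤ v + n + i by omega)]
      at this
    exact le_of_add_le_add_right this
  · obtain rfl : v = m := by omega
    obtain ⟨n, rfl⟩ := Nat.exists_eq_add_of_le huv.1
    obtain ⟨E', hI⟩ := Al.delAll w X Y v n u
    refine ⟨_, _, _, hA.append hI, ?_, by simpa using hS⟩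
    gcongr
    have := hB.pot_del hq
    rw [← sum_Ico_shift_eq (fun o => (1 / 2 : ℝ≥0) * w o none) (u + n) v i hl,
      ← Finset.sum_Ico_consecutive _ (show u ≤ u + n by omega) (show u + n ≤ u + n + i by omega)]
      at this
    exact le_of_add_le_add_right this

/-- Cutting the suffix at the end of the common fragment. -/
theorem Al.suffix (hq : Quasimetric w) {i : ℕ}
    (h : Al w X Y x y x' y' S E c) (hx : x + i ≤ x') (hy : y + i ≤ y')
    (hl : ∀ z < i, lbl X (x + z) = lbl Y (y + z)) :
    ∃ S' E' c', Al w X Y (x + i) (y + i) x' y' S' E' c' ∧ c' ≤ c ∧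
      ∀ f g, (f, g) ∈ S' ↔ (f, g) ∈ S ∧ x + i ≤ f ∧ y + i ≤ g := by
  obtain ⟨u, v, S1, S2, E1, E2, c1, c2, hA, hB, rfl, rfl, rfl, hQ, hh⟩ :=
    h.split (fun u v => x + i ≤ u ∧ y + i ≤ v) (by omega)
  have hAl := hA.le
  have hBl := hB.le
  have huv : u = x + i ∨ v = y + i := by
    rcases hh with ⟨rfl, rfl⟩ | ⟨a, b, h1, _, _, h2⟩
    · omega
    · simp only [AlignStep, Prod.mk.injEq] at h2
      omega
  have hS : ∀ f g, (f, g) ∈ S2 ↔ (f, g) ∈ S1 ++ S2 ∧ x + i ≤ f ∧ y + i ≤ g := by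
    intro f g
    constructor
    · intro h1
      have := hB.mem_bd f g h1
      exact ⟨List.mem_append_right _ h1, by omega, by omega⟩
    · rintro ⟨h1, h2, h3⟩
      rcases List.mem_append.1 h1 with h1 | h1
      · have := hA.mem_bd f g h1
        omega
      · exact h1
  rcases huv with rfl | rfl
  · obtain ⟨n, rfl⟩ := Nat.exists_eq_add_of_le hQ.2
    obtain ⟨E', hI⟩ := Al.insAll w X Y (x + i) n (y + i)
    refine ⟨_, _, _, hI.append hB, ?_, by simpa using hS⟩
    gcongr
    have := hA.pot_ins hq
    rw [sum_Ico_shift_eq (fun o => (1 / 2 : ℝ≥0) * w none o) x y i hl,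
      ← Finset.sum_Ico_consecutive _ (show y ≤ y + i by omega) (show y + i ≤ y + i + n by omega),
      add_comm] at this
    exact le_of_add_le_add_right this
  · obtain ⟨n, rfl⟩ := Nat.exists_eq_add_of_le hQ.1
    obtain ⟨E', hI⟩ := Al.delAll w X Y (y + i) n (x + i)
    refine ⟨_, _, _, hI.append hB, ?_, by simpa using hS⟩
    gcongr
    have := hA.pot_del hq
    rw [← sum_Ico_shift_eq (fun o => (1 / 2 : ℝ≥0) * w o none) x y i hl,
      ← Finset.sum_Ico_consecutive _ (show x ≤ x + i by omega) (show x + i ≤ x + i + n by omega),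
      add_comm] at this
    exact le_of_add_le_add_right this

end AlBasics

/-! ### Forests: stack machine, heights, mates -/

section Forests

variable {α : Type*}

noncomputable def runF : List (Paren α) → List α → Option (List α)
  | [], s => some s
  | (true, a) :: F, s => runF F (a :: s)
  | (false, _) :: _, [] => none
  | (false, a) :: F, b :: s => if a = b then runF F s else none

theorem runF_append (F G : List (Paren α)) : ∀ s, runF (F ++ G) s = (runF F s).bind (runF G) := by
  induction F with
  | nil => intro s; simp [runF]
  | cons c F ih =>
    intro s
    obtain ⟨b, a⟩ := c
    cases b with
    | true => simp [runF, ih]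
    | false =>
      cases s with
      | nil => simp [runF]
      | cons b s =>
        simp only [List.cons_append, runF]
        split_ifs
        · exact ih s
        · rfl

theorem IsForest.runF {F : List (Paren α)} (h : IsForest F) : ∀ s, runF F s = some s := by
  induction h with
  | nil => intro s; simp [_root_.runF]
  | append h1 h2 ih1 ih2 => intro s; simp [runF_append, ih1, ih2]
  | wrap a h ih =>
    intro s
    simp [_root_.runF, runF_append, ih]

def GoodF : List α → List (Paren α) → Prop
  | [], F => IsForest F
  | a :: s, F => ∃ F0 F1, IsForest F0 ∧ F = F0 ++ (false, a) :: F1 ∧ GoodF s F1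

theorem GoodF.prepend {W : List (Paren α)} (hW : IsForest W) {s : List α} {F : List (Paren α)}
    (h : GoodF s F) : GoodF s (W ++ F) := by
  cases s with
  | nil => exact IsForest.append hW h
  | cons a s =>
    obtain ⟨F0, F1, h0, rfl, h1⟩ := h
    exact ⟨W ++ F0, F1, IsForest.append hW h0, by simp, h1⟩

theorem goodF_of_runF (F : List (Paren α)) : ∀ s, runF F s = some [] → GoodF s F := by
  induction F with
  | nil => intro s h; simp [runF] at h; subst h; exact IsForest.nil
  | cons c F ih =>
    intro s h
    obtain ⟨b, a⟩ := c
    cases b with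
    | true =>
      simp only [runF] at h
      obtain ⟨F0, F1, h0, rfl, h1⟩ := ih _ h
      have := GoodF.prepend (IsForest.wrap a h0) h1
      simpa using this
    | false =>
      cases s with
      | nil => simp [runF] at h
      | cons b s =>
        simp only [runF] at h
        split_ifs at h with hab
        subst hab
        exact ⟨[], F, IsForest.nil, by simp, ih _ h⟩

theorem isForest_iff_runF {F : List (Paren α)} : IsForest F ↔ runF F [] = some [] :=
  ⟨fun h => h.runF [], fun h => goodF_of_runF F [] h⟩

theorem isForest_insert {A P B : List (Paren α)} (hP : IsForest P) :
    IsForest (A ++ P ++ B) ↔ IsForest (A ++ B) := by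
  have : runF (A ++ P ++ B) [] = runF (A ++ B) [] := by
    rw [runF_append, runF_append, runF_append, Option.bind_assoc]
    congr 1
    funext s
    simp [hP.runF]
  rw [isForest_iff_runF, isForest_iff_runF, this]

theorem isForest_replace {A P P' B : List (Paren α)} (hP : IsForest P) (hP' : IsForest P') :
    IsForest (A ++ P ++ B) ↔ IsForest (A ++ P' ++ B) := by
  rw [isForest_insert hP, isForest_insert hP']

/-- Height of a string at a boundary. -/
def hgt (P : List (Paren α)) (i : ℕ) : ℤ :=
  ((P.take i).map (fun c => if c.1 then (1 : ℤ) else -1)).sum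

theorem hgt_zero (P : List (Paren α)) : hgt P 0 = 0 := by simp [hgt]

theorem hgt_open {P : List (Paren α)} {i : ℕ} {a : α} (h : P[i]? = some (true, a)) :
    hgt P (i + 1) = hgt P i + 1 := by
  simp [hgt, List.take_add_one, h]

theorem hgt_close {P : List (Paren α)} {i : ℕ} {a : α} (h : P[i]? = some (false, a)) :
    hgt P (i + 1) = hgt P i - 1 := by
  simp [hgt, List.take_add_one, h]
  ring

theorem hgt_congr {P : List (Paren α)} {i j : ℕ} (h : P[i]? = P[j]?) :
    hgt P (i + 1) - hgt P i = hgt P (j + 1) - hgt P j := by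
  simp [hgt, List.take_add_one, h]

theorem hgt_append_left {F G : List (Paren α)} {i : ℕ} (h : i ≤ F.length) :
    hgt (F ++ G) i = hgt F i := by
  simp [hgt, List.take_append_of_le_length h]

theorem hgt_append_right {F G : List (Paren α)} {i : ℕ} :
    hgt (F ++ G) (F.length + i) = hgt F F.length + hgt G i := by
  unfold hgt
  rw [List.take_length_add_append, List.take_length, List.map_append, List.sum_append]

theorem hgt_frag {P : List (Paren α)} {a b m : ℕ} (h : a + m ≤ b) :
    hgt (frag P a b) m = hgt P (a + m) - hgt P a := by
  have : (frag P a b).take m = (P.drop a).take m := by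
    rw [frag, List.drop_take, List.take_take]
    congr 1
    omega
  simp [hgt, this, List.take_add]

theorem hgt_length {P : List (Paren α)} {i : ℕ} (h : P.length ≤ i) : hgt P i = hgt P P.length := by
  simp [hgt, List.take_of_length_le h]

theorem frag_length {P : List (Paren α)} {a b : ℕ} (hb : b ≤ P.length) :
    (frag P a b).length = b - a := by
  simp [frag]; omega

theorem IsForest.hgt_facts {F : List (Paren α)} (h : IsForest F) :
    hgt F F.length = 0 ∧ ∀ i, 0 ≤ hgt F i := by
  induction h with
  | nil => simp [hgt]
  | @append F G h1 h2 ih1 ih2 =>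
    refine ⟨by rw [List.length_append, hgt_append_right, ih1.1, ih2.1]; rfl, fun i => ?_⟩
    rcases le_total i F.length with hi | hi
    · rw [hgt_append_left hi]; exact ih1.2 i
    · obtain ⟨j, rfl⟩ := Nat.exists_eq_add_of_le hi
      rw [hgt_append_right, ih1.1]; simpa using ih2.2 j
  | @wrap F a h ih =>
    have e : (true, a) :: F ++ [(false, a)] = [(true, a)] ++ (F ++ [(false, a)]) := by simp
    have h1 : ∀ i, hgt ((true, a) :: F ++ [(false, a)]) (1 + i) =
        1 + hgt (F ++ [(false, a)]) i := by
      intro i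
      rw [e]
      have := @hgt_append_right _ [(true, a)] (F ++ [(false, a)]) i
      simpa [hgt] using this
    have h2 : ∀ i, F.length < i → hgt (F ++ [(false, a)]) i = -1 := by
      intro i hi
      rw [hgt_length (by simp; omega), List.length_append, hgt_append_right, ih.1]
      simp [hgt]
    refine ⟨?_, fun i => ?_⟩
    · have : ((true, a) :: F ++ [(false, a)]).length = 1 + (F.length + 1) := by simp; omega
      rw [this, h1, h2 _ (by omega)]; rfl
    · rcases Nat.eq_zero_or_pos i with rfl | hi
      · simp [hgt]
      · obtain ⟨j, rfl⟩ := Nat.exists_eq_add_of_le (show 1 ≤ i from hi)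
        rw [h1]
        by_cases hj : F.length < j
        · rw [h2 j hj]; simp
        · rw [hgt_append_left (by omega)]
          have := ih.2 j
          omega

theorem IsNode.hgt_facts {P : List (Paren α)} {i j : ℕ} (h : IsNode P i j) :
    hgt P (j + 1) = hgt P i ∧ ∀ y, i < y → y ≤ j → hgt P i + 1 ≤ hgt P y := by
  obtain ⟨hij, hj, ⟨a, h1, h2⟩, hf⟩ := h
  have ho := hgt_open h1
  have hc := hgt_close h2
  obtain ⟨f1, f2⟩ := hf.hgt_facts
  rw [frag_length (by omega), hgt_frag (by omega)] at f1
  rw [show i + 1 + (j - (i + 1)) = j by omega] at f1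
  refine ⟨by omega, fun y h3 h4 => ?_⟩
  have := f2 (y - (i + 1))
  rw [hgt_frag (by omega), show i + 1 + (y - (i + 1)) = y by omega] at this
  omega

theorem IsNode.right_unique {P : List (Paren α)} {i j j' : ℕ} (h : IsNode P i j)
    (h' : IsNode P i j') : j = j' := by
  have a := h.hgt_facts
  have b := h'.hgt_facts
  have := h.1
  have := h'.1
  rcases lt_trichotomy j j' with hlt | he | hlt
  · have := b.2 (j + 1) (by omega) (by omega); omega
  · exact he
  · have := a.2 (j' + 1) (by omega) (by omega); omega

theorem IsNode.left_unique {P : List (Paren α)} {i i' j : ℕ} (h : IsNode P i j)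
    (h' : IsNode P i' j) : i = i' := by
  have a := h.hgt_facts
  have b := h'.hgt_facts
  have := h.1
  have := h'.1
  rcases lt_trichotomy i i' with hlt | he | hlt
  · have := a.2 i' (by omega) (by omega); omega
  · exact he
  · have := b.2 i (by omega) (by omega); omega

theorem IsNode.not_both {P : List (Paren α)} {i j l : ℕ} (h : IsNode P i j)
    (h' : IsNode P l i) : False := by
  obtain ⟨_, _, ⟨a, h1, _⟩, _⟩ := h
  obtain ⟨_, _, ⟨b, _, h2⟩, _⟩ := h'
  rw [h1] at h2
  simp at h2

theorem MateRel.unique {P : List (Paren α)} {i j j' : ℕ} (h : MateRel P i j)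
    (h' : MateRel P i j') : j = j' := by
  rcases h with h | h <;> rcases h' with h' | h'
  · exact h.right_unique h'
  · exact (h.not_both h').elim
  · exact (h'.not_both h).elim
  · exact h.left_unique h'

theorem MateRel.symm {P : List (Paren α)} {i j : ℕ} (h : MateRel P i j) : MateRel P j i := Or.symm h

theorem getElem?_mid (A P B : List (Paren α)) {i : ℕ} (h : i < P.length) :
    (A ++ P ++ B)[A.length + i]? = P[i]? := by
  rw [List.append_assoc, List.getElem?_append_right (by omega), Nat.add_sub_cancel_left,
    List.getElem?_append_left h]

theorem IsNode.embed (A B : List (Paren α)) {P : List (Paren α)} {i j : ℕ} (h : IsNode P i j) :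
    IsNode (A ++ P ++ B) (A.length + i) (A.length + j) := by
  obtain ⟨hij, hj, ⟨a, h1, h2⟩, hf⟩ := h
  refine ⟨by omega, by simp; omega, ⟨a, ?_, ?_⟩, ?_⟩
  · rw [getElem?_mid _ _ _ (by omega), h1]
  · rw [getElem?_mid _ _ _ (by omega), h2]
  · convert hf using 1
    simp only [frag]
    rw [List.append_assoc, List.take_length_add_append, List.take_append_of_le_length (by omega),
      add_assoc, List.drop_length_add_append]

theorem MateRel.embed (A B : List (Paren α)) {P : List (Paren α)} {i j : ℕ} (h : MateRel P i j) :
    MateRel (A ++ P ++ B) (A.length + i) (A.length + j) :=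
  h.imp (IsNode.embed A B) (IsNode.embed A B)

theorem MateRel.lt_length {P : List (Paren α)} {i j : ℕ} (h : MateRel P i j) :
    i < P.length ∧ j < P.length := by
  rcases h with h | h <;> have := h.1 <;> have := h.2.1 <;> omega

theorem IsForest.exists_mate {F : List (Paren α)} (h : IsForest F) :
    ∀ i, i < F.length → ∃ j, MateRel F i j := by
  induction h with
  | nil => simp
  | @append F G h1 h2 ih1 ih2 =>
    intro i hi
    by_cases hlt : i < F.length
    · obtain ⟨j, hj⟩ := ih1 i hlt
      have := hj.embed [] G
      exact ⟨j, by simpa using this⟩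
    · obtain ⟨j, hj⟩ := ih2 (i - F.length) (by simp at hi; omega)
      have := hj.embed F []
      rw [show F.length + (i - F.length) = i by omega] at this
      exact ⟨_, by simpa using this⟩
  | @wrap F a h ih =>
    intro i hi
    have hn : IsNode ((true, a) :: F ++ [(false, a)]) 0 (F.length + 1) := by
      refine ⟨by omega, by simp, ⟨a, by simp, by simp⟩, ?_⟩
      simpa [frag] using h
    by_cases h0 : i = 0
    · subst h0; exact ⟨_, Or.inl hn⟩
    by_cases h1 : i = F.length + 1
    · subst h1; exact ⟨_, Or.inr hn⟩
    obtain ⟨j, hj⟩ := ih (i - 1) (by simp at hi; omega)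
    have := hj.embed [(true, a)] [(false, a)]
    rw [show [(true, a)].length + (i - 1) = i by simp; omega] at this
    exact ⟨_, by simpa using this⟩

/-- Mates of positions in the middle forest stay in it. -/
theorem MateRel.mid {A P B : List (Paren α)} (hP : IsForest P) {i j : ℕ} (hi : i < P.length)
    (h : MateRel (A ++ P ++ B) (A.length + i) j) : ∃ m, MateRel P i m ∧ j = A.length + m := by
  obtain ⟨m, hm⟩ := hP.exists_mate i hi
  exact ⟨m, hm, h.unique (hm.embed A B)⟩

theorem MateRel.not_mid {A P B : List (Paren α)} (hP : IsForest P) {i j : ℕ}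
    (h : MateRel (A ++ P ++ B) i j) (hi : i < A.length ∨ A.length + P.length ≤ i) :
    j < A.length ∨ A.length + P.length ≤ j := by
  by_contra hcon
  push Not at hcon
  obtain ⟨m, hm, rfl⟩ := MateRel.mid (A := A) (B := B) hP (i := j - A.length) (j := i) (by omega)
    (by rw [show A.length + (j - A.length) = j by omega]; exact h.symm)
  have := hm.lt_length
  omega

theorem getElem?_suf (A P B : List (Paren α)) (i : ℕ) :
    (A ++ P ++ B)[A.length + P.length + i]? = B[i]? := by
  rw [List.getElem?_append_right (by simp), List.length_append, Nat.add_sub_cancel_left]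

theorem getElem?_pre (A P B : List (Paren α)) {i : ℕ} (h : i < A.length) :
    (A ++ P ++ B)[i]? = A[i]? := by
  rw [List.append_assoc, List.getElem?_append_left h]

theorem frag_pre (A P B : List (Paren α)) {i j : ℕ} (h : j ≤ A.length) :
    frag (A ++ P ++ B) i j = frag A i j := by
  rw [frag, frag, List.append_assoc, List.take_append_of_le_length h]

theorem frag_suf (A P B : List (Paren α)) (i j : ℕ) :
    frag (A ++ P ++ B) (A.length + P.length + i) (A.length + P.length + j) = frag B i j := by
  rw [frag, frag, ← List.length_append, List.take_length_add_append, List.drop_length_add_append]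

theorem frag_cross (A P B : List (Paren α)) {i : ℕ} (hi : i ≤ A.length) (j : ℕ) :
    frag (A ++ P ++ B) i (A.length + P.length + j) = A.drop i ++ P ++ B.take j := by
  rw [frag, ← List.length_append, List.take_length_add_append, List.append_assoc,
    List.drop_append_of_le_length hi, List.append_assoc]

/-- Replacing the middle forest keeps nodes outside of it. -/
theorem IsNode.pp {A P P' B : List (Paren α)} {i j : ℕ}
    (h : IsNode (A ++ P ++ B) i j) (hj : j < A.length) : IsNode (A ++ P' ++ B) i j := by
  obtain ⟨hij, _, ⟨a, h1, h2⟩, hf⟩ := h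
  rw [getElem?_pre _ _ _ (by omega)] at h1 h2
  rw [frag_pre _ _ _ (by omega)] at hf
  refine ⟨hij, by simp; omega, ⟨a, ?_, ?_⟩, ?_⟩
  · rw [getElem?_pre _ _ _ (by omega), h1]
  · rw [getElem?_pre _ _ _ (by omega), h2]
  · rwa [frag_pre _ _ _ (by omega)]

theorem IsNode.ps {A P P' B : List (Paren α)} (hP : IsForest P) (hP' : IsForest P') {i j : ℕ}
    (h : IsNode (A ++ P ++ B) i (A.length + P.length + j)) (hi : i < A.length) :
    IsNode (A ++ P' ++ B) i (A.length + P'.length + j) := by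
  obtain ⟨hij, hl, ⟨a, h1, h2⟩, hf⟩ := h
  rw [getElem?_pre _ _ _ (by omega)] at h1
  rw [getElem?_suf] at h2
  rw [frag_cross _ _ _ (by omega)] at hf
  refine ⟨by omega, by simp at hl ⊢; omega, ⟨a, ?_, ?_⟩, ?_⟩
  · rw [getElem?_pre _ _ _ (by omega), h1]
  · rw [getElem?_suf, h2]
  · rw [frag_cross _ _ _ (by omega)]
    exact (isForest_replace hP hP').1 hf

theorem IsNode.ss {A P P' B : List (Paren α)} {i j : ℕ}
    (h : IsNode (A ++ P ++ B) (A.length + P.length + i) (A.length + P.length + j)) :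
    IsNode (A ++ P' ++ B) (A.length + P'.length + i) (A.length + P'.length + j) := by
  obtain ⟨hij, hl, ⟨a, h1, h2⟩, hf⟩ := h
  rw [getElem?_suf] at h1 h2
  rw [add_assoc _ i, frag_suf] at hf
  refine ⟨by omega, by simp at hl ⊢; omega, ⟨a, ?_, ?_⟩, ?_⟩
  · rw [getElem?_suf, h1]
  · rw [getElem?_suf, h2]
  · rwa [add_assoc _ i, frag_suf]

theorem MateRel.pp {A P P' B : List (Paren α)} {i j : ℕ}
    (h : MateRel (A ++ P ++ B) i j) (hi : i < A.length) (hj : j < A.length) :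
    MateRel (A ++ P' ++ B) i j :=
  h.imp (fun h => h.pp hj) (fun h => h.pp hi)

theorem MateRel.ps {A P P' B : List (Paren α)} (hP : IsForest P) (hP' : IsForest P') {i j : ℕ}
    (h : MateRel (A ++ P ++ B) i (A.length + P.length + j)) (hi : i < A.length) :
    MateRel (A ++ P' ++ B) i (A.length + P'.length + j) := by
  rcases h with h | h
  · exact Or.inl (h.ps hP hP' hi)
  · have := h.1; omega

theorem MateRel.ss {A P P' B : List (Paren α)} {i j : ℕ}
    (h : MateRel (A ++ P ++ B) (A.length + P.length + i) (A.length + P.length + j)) :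
    MateRel (A ++ P' ++ B) (A.length + P'.length + i) (A.length + P'.length + j) :=
  h.imp (fun h => h.ss) (fun h => h.ss)

theorem hgt_eq_count (L : List (Paren α)) :
    (L.map (fun c => if c.1 then (1 : ℤ) else -1)).sum =
      (L.countP (fun c => c.1) : ℤ) - (L.countP (fun c => !c.1) : ℤ) := by
  induction L with
  | nil => simp
  | cons c L ih =>
    obtain ⟨b, a⟩ := c
    cases b <;> simp [ih] <;> ring

/-- The key fact on unbalanced periods: some aligned pair has crossing mates. -/
theorem unbalanced_cross {P : List (Paren α)} (hP : IsForest P) {a t : ℕ} (ht : 0 < t)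
    (hlen : a + 2 * t ≤ P.length)
    (hper : ∀ j < t, P[a + j]? = P[a + t + j]?) (hne : hgt P (a + t) ≠ hgt P a) :
    ∃ x u v, a ≤ x ∧ x < a + t ∧ MateRel P x u ∧ MateRel P (x + t) v ∧ v < u := by
  set e := hgt P (a + t) - hgt P a with he
  have hshift : ∀ j ≤ t, hgt P (a + t + j) = hgt P (a + j) + e := by
    intro j
    induction j with
    | zero => intro _; simp [he]
    | succ j ih =>
      intro hj
      have h1 := ih (by omega)
      have h2 := hgt_congr (hper j (by omega))
      rw [← add_assoc, ← add_assoc]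
      omega
  rcases lt_trichotomy e 0 with hneg | h0 | hpos
  · -- first minimizer over `[a + t, a + 2t]`
    obtain ⟨y0, hy0, hmin⟩ := Finset.exists_min_image (Finset.Icc (a + t) (a + 2 * t))
      (fun y => toLex (hgt P y, y)) ⟨a + t, by simp; omega⟩
    rw [Finset.mem_Icc] at hy0
    have hmin' : ∀ y, a + t ≤ y → y ≤ a + 2 * t → hgt P y0 ≤ hgt P y ∧
        (y < y0 → hgt P y0 < hgt P y) := by
      intro y h1 h2
      have := hmin y (Finset.mem_Icc.2 ⟨h1, h2⟩)
      rw [Prod.Lex.le_iff] at this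
      simp at this
      omega
    have hat : a + t < y0 := by
      have h1 := hshift t le_rfl
      have h2 := (hmin' (a + 2 * t) (by omega) le_rfl).1
      rw [show a + t + t = a + 2 * t by omega] at h1
      by_contra hcon
      have : y0 = a + t := by omega
      rw [this] at h2
      omega
    obtain ⟨x, rfl⟩ : ∃ x, y0 = x + t + 1 := ⟨y0 - t - 1, by omega⟩
    have hlow : ∀ y, x + 1 ≤ y → y < x + t + 1 → hgt P (x + t + 1) < hgt P y := by
      intro y h1 h2
      by_cases hc : a + t ≤ y
      · exact (hmin' y hc (by omega)).2 h2
      · have h3 := hshift (y - a) (by omega)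
        rw [show a + t + (y - a) = y + t by omega, show a + (y - a) = y by omega] at h3
        have := (hmin' (y + t) (by omega) (by omega)).1
        omega
    obtain ⟨u, hu⟩ := hP.exists_mate x (by omega)
    obtain ⟨v, hv⟩ := hP.exists_mate (x + t) (by omega)
    refine ⟨x, u, v, by omega, by omega, hu, hv, ?_⟩
    have hch : P[x]? = P[x + t]? := by
      have := hper (x - a) (by omega)
      rwa [show a + (x - a) = x by omega, show a + t + (x - a) = x + t by omega] at this
    have hxt := hlow (x + t) (by omega) (by omega)
    rcases hv with hv | hv
    · obtain ⟨_, _, ⟨b, h1, _⟩, _⟩ := hv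
      have := hgt_open h1
      omega
    rcases hu with hu | hu
    · obtain ⟨_, _, ⟨b, h1, _⟩, _⟩ := hu
      obtain ⟨_, _, ⟨b', _, h2⟩, _⟩ := hv
      rw [hch, h2] at h1
      simp at h1
    have fu := hu.hgt_facts
    have fv := hv.hgt_facts
    have hvx : v ≤ x := by
      by_contra hcon
      have := hlow v (by omega) (by have := hv.1; omega)
      omega
    have hvx' : v ≠ x := by
      rintro rfl
      obtain ⟨_, _, ⟨b, h1, _⟩, _⟩ := hv
      obtain ⟨_, _, ⟨b', _, h2⟩, _⟩ := hu
      rw [h2] at h1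
      simp at h1
    have h3 := hlow (x + 1) le_rfl (by omega)
    by_contra hcon
    rcases eq_or_lt_of_le (not_lt.1 hcon) with rfl | hlt
    · omega
    · have := fu.2 v hlt hvx
      omega
  · omega
  · -- last minimizer over `[a, a + t]`
    obtain ⟨x, hx, hmin⟩ := Finset.exists_min_image (Finset.Icc a (a + t))
      (fun y => toLex (hgt P y, -(y : ℤ))) ⟨a, by simp⟩
    rw [Finset.mem_Icc] at hx
    have hmin' : ∀ y, a ≤ y → y ≤ a + t → hgt P x ≤ hgt P y ∧
        (x < y → hgt P x < hgt P y) := by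
      intro y h1 h2
      have := hmin y (Finset.mem_Icc.2 ⟨h1, h2⟩)
      rw [Prod.Lex.le_iff] at this
      simp at this
      omega
    have hat : x < a + t := by
      have h2 := (hmin' a le_rfl (by omega)).1
      by_contra hcon
      have : x = a + t := by omega
      rw [this] at h2
      omega
    have hlow : ∀ y, x < y → y ≤ x + t → hgt P x < hgt P y := by
      intro y h1 h2
      by_cases hc : y ≤ a + t
      · exact (hmin' y (by omega) hc).2 h1
      · have h3 := hshift (y - a - t) (by omega)
        rw [show a + t + (y - a - t) = y by omega, show a + (y - a - t) = y - t by omega] at h3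
        have := (hmin' (y - t) (by omega) (by omega)).1
        omega
    obtain ⟨u, hu⟩ := hP.exists_mate x (by omega)
    obtain ⟨v, hv⟩ := hP.exists_mate (x + t) (by omega)
    refine ⟨x, u, v, by omega, by omega, hu, hv, ?_⟩
    have hch : P[x]? = P[x + t]? := by
      have := hper (x - a) (by omega)
      rwa [show a + (x - a) = x by omega, show a + t + (x - a) = x + t by omega] at this
    have hxt := hlow (x + 1) (by omega) (by omega)
    rcases hu with hu | hu
    swap
    · obtain ⟨_, _, ⟨b, _, h1⟩, _⟩ := hu
      have := hgt_close h1
      omega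
    rcases hv with hv | hv
    swap
    · obtain ⟨_, _, ⟨b, h1, _⟩, _⟩ := hu
      obtain ⟨_, _, ⟨b', _, h2⟩, _⟩ := hv
      rw [hch, h2] at h1
      simp at h1
    have fu := hu.hgt_facts
    have fv := hv.hgt_facts
    have hux : x + t ≤ u := by
      by_contra hcon
      have := hlow (u + 1) (by have := hu.1; omega) (by omega)
      omega
    have hux' : u ≠ x + t := by
      rintro rfl
      obtain ⟨_, _, ⟨b, _, h1⟩, _⟩ := hu
      obtain ⟨_, _, ⟨b', h2, _⟩, _⟩ := hv
      rw [h2] at h1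
      simp at h1
    have h3 := hlow (x + t) (by omega) le_rfl
    by_contra hcon
    rcases eq_or_lt_of_le (not_lt.1 hcon) with rfl | hlt
    · omega
    · have := fv.2 (u + 1) (by omega) (by omega)
      omega

end Forests

/-! ### The main argument -/

section Main

variable {α : Type*}

theorem lbl_pre (A P B : List (Paren α)) {i : ℕ} (h : i < A.length) :
    lbl (A ++ P ++ B) i = lbl A i := by
  rw [lbl, getElem?_pre _ _ _ h, lbl]

theorem lbl_mid (A P B : List (Paren α)) {i : ℕ} (h : i < P.length) :
    lbl (A ++ P ++ B) (A.length + i) = lbl P i := by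
  rw [lbl, getElem?_mid _ _ _ h, lbl]

theorem lbl_suf (A P B : List (Paren α)) (i : ℕ) :
    lbl (A ++ P ++ B) (A.length + P.length + i) = lbl B i := by
  rw [lbl, getElem?_suf, lbl]

/-- An alignment through a vertex of the diagonal of `P` yields one after replacing `P`. -/
theorem al_replace {w : Option α → Option α → ℝ≥0} (hw : Normalized w) (hq : Quasimetric w)
    {F1 F2 G1 G2 P P' : List (Paren α)} (hP : IsForest P) (hP' : IsForest P')
    {i : ℕ} (hi : i ≤ P.length) {S1 S2 : List (ℕ × ℕ)} {E1 E2 : List ℕ} {c1 c2 : ℝ≥0}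
    (h1 : Al w (F1 ++ P ++ F2) (G1 ++ P ++ G2) 0 0 (F1.length + i) (G1.length + i) S1 E1 c1)
    (h2 : Al w (F1 ++ P ++ F2) (G1 ++ P ++ G2) (F1.length + i) (G1.length + i)
      (F1 ++ P ++ F2).length (G1 ++ P ++ G2).length S2 E2 c2)
    (hcons : ∀ f g f' g', (f, g) ∈ S1 ++ S2 → MateRel (F1 ++ P ++ F2) f f' →
      MateRel (G1 ++ P ++ G2) g g' → (f', g') ∈ S1 ++ S2) :
    ∃ S E c, Al w (F1 ++ P' ++ F2) (G1 ++ P' ++ G2) 0 0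
        (F1 ++ P' ++ F2).length (G1 ++ P' ++ G2).length S E c ∧ c ≤ c1 + c2 ∧
      ∀ f g f' g', (f, g) ∈ S → MateRel (F1 ++ P' ++ F2) f f' →
        MateRel (G1 ++ P' ++ G2) g g' → (f', g') ∈ S := by
  obtain ⟨T1, D1, d1, hT1, hd1, hm1⟩ := h1.prefix hq (Nat.zero_le _) (Nat.zero_le _)
    (fun z hz => by rw [lbl_mid _ _ _ (by omega), lbl_mid _ _ _ (by omega)])
  obtain ⟨T2, D2, d2, hT2, hd2, hm2⟩ := h2.suffix hq (i := P.length - i)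
    (by simp; omega) (by simp; omega)
    (fun z hz => by
      rw [add_assoc, add_assoc, lbl_mid _ _ _ (by omega), lbl_mid _ _ _ (by omega)])
  rw [show F1.length + i + (P.length - i) = F1.length + P.length by omega,
    show G1.length + i + (P.length - i) = G1.length + P.length by omega] at hT2 hm2
  -- transfer
  obtain ⟨U1, _, hU1, hu1⟩ := hT1.shift (X' := F1 ++ P' ++ F2) (Y' := G1 ++ P' ++ G2)
    (r := 0) (r' := 0) (s := 0) (s' := 0) 0 0 F1.length G1.length (by simp) (by simp) (by simp)
    (by simp) (fun j hj => by rw [zero_add, lbl_pre _ _ _ hj, lbl_pre _ _ _ hj])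
    (fun j hj => by rw [zero_add, lbl_pre _ _ _ hj, lbl_pre _ _ _ hj])
  obtain ⟨U2, _, hU2, hu2⟩ := hT2.shift (X' := F1 ++ P' ++ F2) (Y' := G1 ++ P' ++ G2)
    (r := F1.length + P.length) (r' := F1.length + P'.length)
    (s := G1.length + P.length) (s' := G1.length + P'.length) 0 0 F2.length G2.length
    (by simp [add_assoc]) (by simp [add_assoc]) (by simp [add_assoc]) (by simp [add_assoc])
    (fun j hj => by rw [lbl_suf, lbl_suf]) (fun j hj => by rw [lbl_suf, lbl_suf])
  obtain ⟨Ud, _, hUd, hud⟩ := Al.diagAll hw (F1 ++ P' ++ F2) (G1 ++ P' ++ G2) P'.length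
    F1.length G1.length (fun j hj => by rw [lbl_mid _ _ _ hj, lbl_mid _ _ _ hj])
  simp only [zero_add, add_zero] at hU1 hU2
  have hA := (hU1.append hUd).append hU2
  have hb1 := h1.mem_bd
  have hb2 := h2.mem_bd
  -- membership in the new alignment
  have mem_pre : ∀ f g, (f, g) ∈ S1 ++ S2 → f < F1.length → g < G1.length →
      (f, g) ∈ U1 ++ Ud ++ U2 := by
    intro f g hm hf hg
    have : (f, g) ∈ S1 := by
      rcases List.mem_append.1 hm with h | h
      · exact h
      · have := hb2 f g h; omega
    refine List.mem_append_left _ (List.mem_append_left _ ((hu1 f g).2 ⟨f, g, by simp, by simp, ?_⟩))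
    simpa using (hm1 f g).2 ⟨this, hf, hg⟩
  have mem_suf : ∀ a b, (F1.length + P.length + a, G1.length + P.length + b) ∈ S1 ++ S2 →
      (F1.length + P'.length + a, G1.length + P'.length + b) ∈ U1 ++ Ud ++ U2 := by
    intro a b hm
    have : (F1.length + P.length + a, G1.length + P.length + b) ∈ S2 := by
      rcases List.mem_append.1 hm with h | h
      · have := hb1 _ _ h; omega
      · exact h
    exact List.mem_append_right _ ((hu2 _ _).2 ⟨a, b, rfl, rfl, (hm2 _ _).2
      ⟨this, by omega, by omega⟩⟩)
  have e1 : (F1 ++ P' ++ F2).length = F1.length + P'.length + F2.length := by simp [add_assoc]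
  have e2 : (G1 ++ P' ++ G2).length = G1.length + P'.length + G2.length := by simp [add_assoc]
  refine ⟨_, _, _, by rw [e1, e2]; exact hA, ?_, ?_⟩
  · simpa using add_le_add hd1 hd2
  · intro f g f' g' hm hf hg
    rcases List.mem_append.1 hm with hm | hm
    · rcases List.mem_append.1 hm with hm | hm
      · -- prefix
        obtain ⟨a, b, ha, hb, hm⟩ := (hu1 f g).1 hm
        simp only [zero_add] at ha hb hm
        subst ha hb
        obtain ⟨hmS, hfl, hgl⟩ := (hm1 f g).1 hm
        have hmS' : (f, g) ∈ S1 ++ S2 := List.mem_append_left _ hmS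
        rcases hf.not_mid hP' (Or.inl hfl) with hf' | hf' <;>
          rcases hg.not_mid hP' (Or.inl hgl) with hg' | hg'
        · exact mem_pre _ _ (hcons _ _ _ _ hmS' (hf.pp hfl hf') (hg.pp hgl hg')) hf' hg'
        · obtain ⟨b, rfl⟩ := Nat.exists_eq_add_of_le hg'
          have := hcons _ _ _ _ hmS' (hf.pp hfl hf') (hg.ps hP' hP hgl)
          rcases List.mem_append.1 this with h | h
          · have := hb1 _ _ h; omega
          · have := hb2 _ _ h; omega
        · obtain ⟨a, rfl⟩ := Nat.exists_eq_add_of_le hf'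
          have := hcons _ _ _ _ hmS' (hf.ps hP' hP hfl) (hg.pp hgl hg')
          rcases List.mem_append.1 this with h | h
          · have := hb1 _ _ h; omega
          · have := hb2 _ _ h; omega
        · obtain ⟨a, rfl⟩ := Nat.exists_eq_add_of_le hf'
          obtain ⟨b, rfl⟩ := Nat.exists_eq_add_of_le hg'
          exact mem_suf _ _ (hcons _ _ _ _ hmS' (hf.ps hP' hP hfl) (hg.ps hP' hP hgl))
      · -- diagonal
        obtain ⟨j, hj, rfl, rfl⟩ := (hud f g).1 hm
        obtain ⟨m, hm1, rfl⟩ := hf.mid hP' hj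
        obtain ⟨m', hm2, rfl⟩ := hg.mid hP' hj
        obtain rfl := hm1.unique hm2
        exact List.mem_append_left _ (List.mem_append_right _ ((hud _ _).2
          ⟨m, hm1.lt_length.2, rfl, rfl⟩))
    · -- suffix
      obtain ⟨a, b, rfl, rfl, hmT⟩ := (hu2 f g).1 hm
      obtain ⟨hmS, hfl, hgl⟩ := (hm2 _ _).1 hmT
      have hmS' : (F1.length + P.length + a, G1.length + P.length + b) ∈ S1 ++ S2 :=
        List.mem_append_right _ hmS
      rcases hf.not_mid hP' (Or.inr (by omega)) with hf' | hf' <;>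
        rcases hg.not_mid hP' (Or.inr (by omega)) with hg' | hg'
      · exact mem_pre _ _ (hcons _ _ _ _ hmS' (hf.symm.ps hP' hP hf').symm
          (hg.symm.ps hP' hP hg').symm) hf' hg'
      · obtain ⟨b, rfl⟩ := Nat.exists_eq_add_of_le hg'
        have := hcons _ _ _ _ hmS' (hf.symm.ps hP' hP hf').symm hg.ss
        rcases List.mem_append.1 this with h | h
        · have := hb1 _ _ h; omega
        · have := hb2 _ _ h; omega
      · obtain ⟨a, rfl⟩ := Nat.exists_eq_add_of_le hf'
        have := hcons _ _ _ _ hmS' hf.ss (hg.symm.ps hP' hP hg').symm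
        rcases List.mem_append.1 this with h | h
        · have := hb1 _ _ h; omega
        · have := hb2 _ _ h; omega
      · obtain ⟨a, rfl⟩ := Nat.exists_eq_add_of_le hf'
        obtain ⟨b, rfl⟩ := Nat.exists_eq_add_of_le hg'
        exact mem_suf _ _ (hcons _ _ _ _ hmS' hf.ss hg.ss)

theorem Al.cross_pair {w : Option α → Option α → ℝ≥0} {X Y : List (Paren α)}
    {x y x' y' : ℕ} {S : List (ℕ × ℕ)} {E : List ℕ} {c : ℝ≥0}
    (h : Al w X Y x y x' y' S E c) {f g f' g' a b : ℕ} (h1 : (f, g) ∈ S) (h2 : (f', g') ∈ S)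
    (hff : f ≤ f') (hab : (f + b ≤ g + a ∧ g' + a ≤ f' + b) ∨ (g + a ≤ f + b ∧ f' + b ≤ g' + a)) :
    ∃ u v S1 S2 E1 E2 c1 c2, Al w X Y x y u v S1 E1 c1 ∧ Al w X Y u v x' y' S2 E2 c2 ∧
      S = S1 ++ S2 ∧ c = c1 + c2 ∧ u + b = v + a ∧ f ≤ u ∧ u ≤ f' ∧ g ≤ v ∧ v ≤ g' := by
  obtain ⟨Sa, Sb, Ea, Eb, ca, cb, hA, hB, rfl, rfl, rfl⟩ := h.split_mem f g h1
  have hmem : (f', g') ∈ Sb := by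
    rcases List.mem_append.1 h2 with h2 | h2
    · have := hA.mem_bd _ _ h2; omega
    · exact h2
  obtain ⟨Sc, Sd, Ec, Ed, cc, cd, hC, hD, rfl, rfl, rfl⟩ := hB.split_mem f' g' hmem
  rcases hab with hab | hab
  · obtain ⟨u, v, S1, S2, E1, E2, c1, c2, hU, hV, rfl, rfl, rfl, huv⟩ := hC.cross_up hab.1 hab.2
    have := hU.le
    have := hV.le
    exact ⟨u, v, _, _, _, _, _, _, hA.append hU, hV.append hD, by simp, by simp [add_assoc], huv,
      by omega, by omega, by omega, by omega⟩
  · obtain ⟨u, v, S1, S2, E1, E2, c1, c2, hU, hV, rfl, rfl, rfl, huv⟩ := hC.cross_dn hab.1 hab.2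
    have := hU.le
    have := hV.le
    exact ⟨u, v, _, _, _, _, _, _, hA.append hU, hV.append hD, by simp, by simp [add_assoc], huv,
      by omega, by omega, by omega, by omega⟩

/-- Aligned characters with equal labels are equal characters. -/
theorem Al.char_eq {w : Option α → Option α → ℝ≥0} {X Y : List (Paren α)}
    {x y x' y' : ℕ} {S : List (ℕ × ℕ)} {E : List ℕ} {c : ℝ≥0}
    (h : Al w X Y x y x' y' S E c) (hX : IsForest X) (hY : IsForest Y)
    (hx' : x' ≤ X.length) (hy' : y' ≤ Y.length)
    (hcons : ∀ f g f' g', (f, g) ∈ S → MateRel X f f' → MateRel Y g g' → (f', g') ∈ S)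
    {f g : ℕ} (hm : (f, g) ∈ S) (hE : f ∉ E) : X[f]? = Y[g]? := by
  have hl := h.lbl_eq f g hm hE
  have hb := h.mem_bd f g hm
  obtain ⟨f', hf⟩ := hX.exists_mate f (by omega)
  obtain ⟨g', hg⟩ := hY.exists_mate g (by omega)
  have hm' := hcons _ _ _ _ hm hf hg
  rcases hf with hf | hf <;> rcases hg with hg | hg
  · obtain ⟨_, _, ⟨b, h1, _⟩, _⟩ := hf
    obtain ⟨_, _, ⟨b', h2, _⟩, _⟩ := hg
    simp only [lbl, h1, h2, Option.map_some, Option.some.injEq] at hl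
    rw [h1, h2, hl]
  · have := h.mono _ _ _ _ hm hm' hf.1
    have := hg.1
    omega
  · have := h.mono _ _ _ _ hm' hm hf.1
    have := hg.1
    omega
  · obtain ⟨_, _, ⟨b, _, h1⟩, _⟩ := hf
    obtain ⟨_, _, ⟨b', _, h2⟩, _⟩ := hg
    simp only [lbl, h1, h2, Option.map_some, Option.some.injEq] at hl
    rw [h1, h2, hl]

theorem black_of_run {k : ℕ} {P : List (Paren α)} {a t i : ℕ} (ht : 0 < t) (htk : t ≤ 4 * k)
    (hlen : a + t + 42 * k ≤ P.length)
    (hper : ∀ j < 42 * k, P[a + j]? = P[a + t + j]?) (hbal : hgt P (a + t) = hgt P a)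
    (h1 : a + 5 * k ≤ i) (h2 : i + 5 * k < a + t + 42 * k) : IsBlack k P i := by
  have hget : ∀ j, j < t + 42 * k → (frag P a (a + t + 42 * k))[j]? = P[a + j]? := by
    intro j hj
    rw [frag, List.getElem?_drop, List.getElem?_take_of_lt (by omega)]
  have hl := @frag_length α P a (a + t + 42 * k) hlen
  refine ⟨a, a + t + 42 * k, hlen, h1, h2, by omega, t, ht, htk, fun j hj => ?_, ?_⟩
  · rw [hget _ (by omega), hget _ (by omega), hper j (by omega)]
    congr 1
    omega
  · have h3 := @hgt_frag α P a (a + t + 42 * k) t (by omega)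
    rw [hgt, hgt_eq_count, hbal] at h3
    omega

/-- The alignment must visit the diagonal of `P` when `P` has many red characters. -/
theorem exists_diag_vertex {k : ℕ} (hk : 0 < k) {w : Option α → Option α → ℝ≥0}
    {F1 F2 G1 G2 P : List (Paren α)} (hP : IsForest P)
    (hF : IsForest (F1 ++ P ++ F2)) (hG : IsForest (G1 ++ P ++ G2))
    (ho1 : F1.length ≤ G1.length + 2 * k) (ho2 : G1.length ≤ F1.length + 2 * k)
    (hred : 158 * k ^ 2 ≤ redCount k P) {S : List (ℕ × ℕ)} {E : List ℕ} {c : ℝ≥0}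
    (h : Al w (F1 ++ P ++ F2) (G1 ++ P ++ G2) 0 0
      (F1 ++ P ++ F2).length (G1 ++ P ++ G2).length S E c)
    (hE : E.length ≤ 2 * k)
    (hcons : ∀ f g f' g', (f, g) ∈ S → MateRel (F1 ++ P ++ F2) f f' →
      MateRel (G1 ++ P ++ G2) g g' → (f', g') ∈ S) :
    ∃ i ≤ P.length, ∃ S1 S2 E1 E2 c1 c2,
      Al w (F1 ++ P ++ F2) (G1 ++ P ++ G2) 0 0 (F1.length + i) (G1.length + i) S1 E1 c1 ∧
      Al w (F1 ++ P ++ F2) (G1 ++ P ++ G2) (F1.length + i) (G1.length + i)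
        (F1 ++ P ++ F2).length (G1 ++ P ++ G2).length S2 E2 c2 ∧ S = S1 ++ S2 ∧ c = c1 + c2 := by
  by_contra hno
  -- crossing pairs are impossible
  have hcross : ∀ x y u v, x < P.length → y < P.length → u < P.length → v < P.length →
      (F1.length + x, G1.length + y) ∈ S → (F1.length + u, G1.length + v) ∈ S →
      x ≤ y → v ≤ u → False := by
    intro x y u v hx hy hu hv hm1 hm2 hxy hvu
    have fin : ∀ p q S1 S2 E1 E2 c1 c2,
        Al w (F1 ++ P ++ F2) (G1 ++ P ++ G2) 0 0 p q S1 E1 c1 →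
        Al w (F1 ++ P ++ F2) (G1 ++ P ++ G2) p q
          (F1 ++ P ++ F2).length (G1 ++ P ++ G2).length S2 E2 c2 → S = S1 ++ S2 → c = c1 + c2 →
        p + G1.length = q + F1.length → F1.length ≤ p → p ≤ F1.length + P.length → False := by
      intro p q S1 S2 E1 E2 c1 c2 hA hB hS hc hpq h1 h2
      obtain ⟨i, rfl⟩ := Nat.exists_eq_add_of_le h1
      obtain rfl : q = G1.length + i := by omega
      exact hno ⟨i, by omega, S1, S2, E1, E2, c1, c2, hA, hB, hS, hc⟩
    rcases le_total x u with hxu | hux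
    · obtain ⟨p, q, S1, S2, E1, E2, c1, c2, hA, hB, hS, hc, hpq, h1, h2, _, _⟩ :=
        h.cross_pair (a := F1.length) (b := G1.length) hm1 hm2 (by omega) (Or.inl (by omega))
      exact fin _ _ _ _ _ _ _ _ hA hB hS hc hpq (by omega) (by omega)
    · obtain ⟨p, q, S1, S2, E1, E2, c1, c2, hA, hB, hS, hc, hpq, h1, h2, _, _⟩ :=
        h.cross_pair (a := F1.length) (b := G1.length) hm2 hm1 (by omega) (Or.inr (by omega))
      exact fin _ _ _ _ _ _ _ _ hA hB hS hc hpq (by omega) (by omega)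
  have hFl : (F1 ++ P ++ F2).length = F1.length + P.length + F2.length := by simp [add_assoc]
  have hGl : (G1 ++ P ++ G2).length = G1.length + P.length + G2.length := by simp [add_assoc]
  -- every red character (away from the ends) is close to an edit
  have hnear : ∀ i, 9 * k ≤ i → i + 42 * k ≤ P.length → ¬ IsBlack k P i →
      ∃ e ∈ E, F1.length + i ≤ e + 5 * k ∧ e ≤ F1.length + i + 37 * k := by
    intro i hi1 hi2 hnb
    by_contra hfar
    push Not at hfar
    have hfree : ∀ j, j ≤ 42 * k → F1.length + (i - 5 * k) + j ∉ E := by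
      intro j hj hmem
      have := hfar _ hmem (by omega)
      omega
    obtain ⟨g0, hg0⟩ := h.exists_mem (F1.length + (i - 5 * k)) (by omega) (by omega)
      (by simpa using hfree 0 (by omega))
    have hrun : ∀ j, j ≤ 42 * k → (F1.length + (i - 5 * k) + j, g0 + j) ∈ S := by
      intro j
      induction j with
      | zero => intro _; simpa using hg0
      | succ j ih =>
        intro hj
        exact h.next (F1.length + (i - 5 * k) + j) (g0 + j) (ih (by omega)) (by omega)
          (hfree (j + 1) hj)
    have hoff : g0 ≤ F1.length + (i - 5 * k) + 2 * k ∧ F1.length + (i - 5 * k) ≤ g0 + 2 * k := by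
      obtain ⟨Sa, Sb, Ea, Eb, ca, cb, hA, hB, rfl, rfl, rfl⟩ := h.split_mem _ _ hg0
      have := hA.off
      simp only [List.length_append] at hE
      omega
    obtain ⟨b, rfl⟩ : ∃ b, g0 = G1.length + b := ⟨g0 - G1.length, by omega⟩
    obtain ⟨a, rfl⟩ : ∃ a, i = a + 5 * k := ⟨i - 5 * k, by omega⟩
    simp only [Nat.add_sub_cancel] at hrun hoff hfree hg0
    have hch : ∀ j, j ≤ 42 * k → P[a + j]? = P[b + j]? := by
      intro j hj
      have := h.char_eq hF hG le_rfl le_rfl hcons (hrun j hj) (hfree j hj)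
      rwa [add_assoc, add_assoc, getElem?_mid _ _ _ (by omega), getElem?_mid _ _ _ (by omega)]
        at this
    rcases lt_trichotomy a b with hab | hab | hab
    · obtain ⟨t, rfl⟩ := Nat.exists_eq_add_of_le hab.le
      have hunb : hgt P (a + t) ≠ hgt P a := fun hbal => hnb
        (black_of_run (by omega) (by omega) (by omega) (fun j hj => hch j (by omega)) hbal
          (by omega) (by omega))
      obtain ⟨x, u, v, hx1, hx2, hu, hv, hvu⟩ := unbalanced_cross hP (by omega) (by omega)
        (fun j hj => hch j (by omega)) hunb
      have hm := hrun (x - a) (by omega)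
      rw [show F1.length + a + (x - a) = F1.length + x by omega,
        show G1.length + (a + t) + (x - a) = G1.length + (x + t) by omega] at hm
      have hm' := hcons _ _ _ _ hm (hu.embed F1 F2) (hv.embed G1 G2)
      exact hcross x (x + t) u v (by omega) (by omega) hu.lt_length.2 hv.lt_length.2 hm hm'
        (by omega) (by omega)
    · subst hab
      exact hcross a a a a (by omega) (by omega) (by omega) (by omega) hg0 hg0 le_rfl le_rfl
    · obtain ⟨t, rfl⟩ := Nat.exists_eq_add_of_le hab.le
      have hunb : hgt P (b + t) ≠ hgt P b := fun hbal => hnb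
        (black_of_run (by omega) (by omega) (by omega) (fun j hj => (hch j (by omega)).symm) hbal
          (by omega) (by omega))
      obtain ⟨x, u, v, hx1, hx2, hu, hv, hvu⟩ := unbalanced_cross hP (by omega) (by omega)
        (fun j hj => (hch j (by omega)).symm) hunb
      have hm := hrun (x - b) (by omega)
      rw [show F1.length + (b + t) + (x - b) = F1.length + (x + t) by omega,
        show G1.length + b + (x - b) = G1.length + x by omega] at hm
      have hm' := hcons _ _ _ _ hm (hv.embed F1 F2) (hu.embed G1 G2)
      exact hcross v u (x + t) x hv.lt_length.2 hu.lt_length.2 (by omega) (by omega) hm' hm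
        (by omega) (by omega)
  -- counting
  have hsub : ((Finset.range P.length).filter fun i => ¬ IsBlack k P i) ⊆
      Finset.range (9 * k) ∪ (Finset.Ico (P.length - 42 * k) P.length ∪
        E.toFinset.biUnion (fun e =>
          Finset.Icc (e - (F1.length + 37 * k)) (e + 5 * k - F1.length))) := by
    intro i hi
    simp only [Finset.mem_filter, Finset.mem_range] at hi
    simp only [Finset.mem_union, Finset.mem_range, Finset.mem_Ico, Finset.mem_biUnion,
      List.mem_toFinset, Finset.mem_Icc]
    by_cases h1 : i < 9 * k
    · exact Or.inl h1
    by_cases h2 : i + 42 * k ≤ P.length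
    · obtain ⟨e, he, h3, h4⟩ := hnear i (by omega) h2 hi.2
      exact Or.inr (Or.inr ⟨e, he, by omega, by omega⟩)
    · exact Or.inr (Or.inl (by omega))
  have hcard : redCount k P ≤ 9 * k + (42 * k + E.length * (42 * k + 1)) := by
    refine (Finset.card_le_card hsub).trans ((Finset.card_union_le _ _).trans ?_)
    gcongr
    · simp
    · refine (Finset.card_union_le _ _).trans ?_
      gcongr
      · simp; omega
      · refine (Finset.card_biUnion_le_card_mul _ _ (42 * k + 1) ?_).trans ?_
        · intro e _
          simp; omega
        · gcongr
          exact List.toFinset_card_le E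
  have : E.length * (42 * k + 1) ≤ 2 * k * (42 * k + 1) := by gcongr
  nlinarith

theorem ted_replace_le {k : ℕ} (hk : 0 < k) {w : Option α → Option α → ℝ≥0}
    (hw : Normalized w) (hq : Quasimetric w)
    {F1 F2 G1 G2 P P' : List (Paren α)} (hP : IsForest P) (hP' : IsForest P')
    (hF : IsForest (F1 ++ P ++ F2)) (hG : IsForest (G1 ++ P ++ G2))
    (ho1 : F1.length ≤ G1.length + 2 * k) (ho2 : G1.length ≤ F1.length + 2 * k)
    (hred : 158 * k ^ 2 ≤ redCount k P)
    (hle : tedFrag w (F1 ++ P ++ F2) (G1 ++ P ++ G2) 0 (F1 ++ P ++ F2).length 0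
      (G1 ++ P ++ G2).length ≤ (k : ℝ≥0∞)) :
    tedFrag w (F1 ++ P' ++ F2) (G1 ++ P' ++ G2) 0 (F1 ++ P' ++ F2).length 0
      (G1 ++ P' ++ G2).length ≤
    tedFrag w (F1 ++ P ++ F2) (G1 ++ P ++ G2) 0 (F1 ++ P ++ F2).length 0
      (G1 ++ P ++ G2).length := by
  have key : ∀ p : { p : List (ℕ × ℕ) // IsAlignment 0 (F1 ++ P ++ F2).length 0
      (G1 ++ P ++ G2).length p ∧ Consistent (F1 ++ P ++ F2) (G1 ++ P ++ G2) p },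
      pathCost w (F1 ++ P ++ F2) (G1 ++ P ++ G2) p.1 < (k : ℝ≥0) + 1 / 2 →
      tedFrag w (F1 ++ P' ++ F2) (G1 ++ P' ++ G2) 0 (F1 ++ P' ++ F2).length 0
        (G1 ++ P' ++ G2).length ≤
      (pathCost w (F1 ++ P ++ F2) (G1 ++ P ++ G2) p.1 : ℝ≥0∞) := by
    rintro ⟨p, hal, hco⟩ hlt
    simp only at hlt ⊢
    obtain ⟨S, E, hA, hS⟩ := Al.of_list w _ _ p _ _ _ _ hal
    have hcons : ∀ f g f' g', (f, g) ∈ S → MateRel (F1 ++ P ++ F2) f f' →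
        MateRel (G1 ++ P ++ G2) g g' → (f', g') ∈ S := by
      intro f g f' g' h1 h2 h3
      rw [hS] at h1 ⊢
      exact hco _ _ _ _ h1 h2 h3
    have hE : E.length ≤ 2 * k := by
      have h1 := hA.edits hw le_rfl le_rfl
      have h2 : (E.length : ℝ≥0) < ((2 * k + 1 : ℕ) : ℝ≥0) := by
        refine h1.trans_lt ?_
        have h3 : 2 * pathCost w (F1 ++ P ++ F2) (G1 ++ P ++ G2) p < 2 * ((k : ℝ≥0) + 1 / 2) :=
          mul_lt_mul_of_pos_left hlt (by norm_num)
        refine h3.trans_le (le_of_eq ?_)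
        push_cast
        rw [mul_add]
        norm_num
      have := Nat.cast_lt.1 h2
      omega
    obtain ⟨i, hi, S1, S2, E1, E2, c1, c2, h1, h2, rfl, hc⟩ :=
      exists_diag_vertex hk hP hF hG ho1 ho2 hred hA hE hcons
    obtain ⟨S', E', c', hA', hc', hcons'⟩ := al_replace hw hq hP hP' hi h1 h2 hcons
    obtain ⟨p', hal', hcost, hS'⟩ := hA'.to_list
    have hco' : Consistent (F1 ++ P' ++ F2) (G1 ++ P' ++ G2) p' := by
      intro f g f' g' h1 h2 h3
      rw [← hS'] at h1 ⊢
      exact hcons' _ _ _ _ h1 h2 h3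
    refine (iInf_le _ ⟨p', hal', hco'⟩).trans ?_
    change ((pathCost w (F1 ++ P' ++ F2) (G1 ++ P' ++ G2) p' : ℝ≥0) : ℝ≥0∞) ≤ _
    rw [hcost, hc]
    exact_mod_cast hc'
  by_contra hcon
  rw [not_le] at hcon
  have hlt : tedFrag w (F1 ++ P ++ F2) (G1 ++ P ++ G2) 0 (F1 ++ P ++ F2).length 0
      (G1 ++ P ++ G2).length <
      min (tedFrag w (F1 ++ P' ++ F2) (G1 ++ P' ++ G2) 0 (F1 ++ P' ++ F2).length 0
        (G1 ++ P' ++ G2).length) (((k : ℝ≥0) + 1 / 2 : ℝ≥0) : ℝ≥0∞) := by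
    refine lt_min hcon (hle.trans_lt ?_)
    have : (k : ℝ≥0) < (k : ℝ≥0) + 1 / 2 := lt_add_of_pos_right _ (by norm_num)
    exact_mod_cast this
  conv_lhs at hlt => rw [tedFrag]
  obtain ⟨p, hp⟩ := iInf_lt_iff.1 hlt
  have h1 := hp.trans_le (min_le_left _ _)
  have h2 := hp.trans_le (min_le_right _ _)
  exact absurd (key p (by exact_mod_cast h2)) (not_le.2 h1)

end Main

/-- Lemma C.7: for `k ∈ ℤ₊`, any two forests `P` and `P'` with
at least `158k²` red characters each are `ted^w_{≤k}`-equivalent for every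
normalized quasimetric weight function `w`. -/
theorem forest_equiv_of_many_red {α : Type*} (k : ℕ) (hk : 0 < k)
    (P P' : List (Paren α)) (hP : IsForest P) (hP' : IsForest P')
    (hred : 158 * k ^ 2 ≤ redCount k P) (hred' : 158 * k ^ 2 ≤ redCount k P') :
    ∀ w : Option α → Option α → ℝ≥0, Normalized w → Quasimetric w →
      ForestEquiv k w P P' := by

  intro w hw hq F1 F2 G1 G2 hF hG ho1 ho2
  have hF' := (isForest_replace hP hP').1 hF
  have hG' := (isForest_replace hP hP').1 hG
  have h1 := ted_replace_le hk hw hq hP hP' hF hG ho1 ho2 hred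
  have h2 := ted_replace_le hk hw hq hP' hP hF' hG' ho1 ho2 hred'
  unfold tedLE
  split_ifs with ha hb hb
  · exact le_antisymm (h2 hb) (h1 ha)
  · exact absurd ((h1 ha).trans ha) hb
  · exact absurd ((h2 hb).trans hb) ha
  · rfl
end
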